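/- arXiv:2207.08957 — 3 statements merged into one kernel-verified Lean document; each statement's English description precedes it below -/
import Mathlib

section
/- Let F be a p-dense foliation of codimension q on a smooth algebraic variety X over an algebraically closed field k of characteristic p > 0. Then there exist closed rational 1-forms ω₁, …, ω_q on X which vanish on T_F and satisfy ω₁ ∧ ⋯ ∧ ω_q ≠ 0. -/
/-!
# Statement 0 (Proposition "P:closed" of the paper)

If `F` is a `p`-dense foliation of codimension `q` on a smooth algebraic
variety `X` over an algebraically closed field `k` of characteristic `p > 0`,
then there exist closed rational 1-forms `ω₁, …, ω_q` vanishing on `T_F` with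
`ω₁ ∧ ⋯ ∧ ω_q ≠ 0`.

We work with the standard birational model of a smooth algebraic variety over
`k`: its function field `K`, a finitely generated field extension of `k`.
Rational vector fields on `X` are the `k`-derivations of `K`, rational
1-forms are the Kähler differentials `Ω[K⁄k]`, and a (saturated) foliation is
determined by its generic data: an involutive `K`-subspace `W ⊆ Der_k(K)`
(the rational sections of `T_F`).  Closedness of a rational `1`-form is
expressed through Cartan's formula for the exterior derivative, and the
nonvanishing of the wedge `ω₁ ∧ ⋯ ∧ ω_q` is expressed in the exterior algebra
of the `K`-module `Ω[K⁄k]`.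
-/

open scoped ExteriorAlgebra

/-- A rational 1-form `ω` on a variety with function field `K` over `k` is
closed if Cartan's formula for its exterior derivative,
`dω(u,v) = u(ω(v)) - v(ω(u)) - ω([u,v])`, vanishes for all rational vector
fields `u`, `v`. -/
def IsClosedRationalOneForm (k K : Type*) [CommRing k] [CommRing K] [Algebra k K]
    (ω : Ω[K⁄k]) : Prop :=
  ∀ u v : Derivation k K K,
    u (v.liftKaehlerDifferential ω) - v (u.liftKaehlerDifferential ω) =
      (⁅u, v⁆ : Derivation k K K).liftKaehlerDifferential ω

section Derivations

open Module

lemma exists_basis_dual_to_separating_family {K V X : Type*} [Field K] [AddCommGroup V]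
    [Module K V] [FiniteDimensional K V] (ev : X → Dual K V)
    (hsep : ∀ v : V, (∀ x, ev x v = 0) → v = 0) :
    ∃ (x : Fin (finrank K V) → X) (b : Basis (Fin (finrank K V)) K V),
      ∀ i, ev (x i) = b.coord i := by
  have hspan : Submodule.span K (Set.range ev) = ⊤ := by
    apply Submodule.span_eq_top_of_ne_zero (R := K)
    intro z hz
    by_contra! h
    exact hz (hsep z fun x => h _ ⟨x, rfl⟩)
  obtain ⟨κ, a, ha, hs, hli⟩ := exists_linearIndependent' K ev
  let c : Basis κ K (Dual K V) := Basis.mk hli (by rw [hs, hspan])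
  have : Fintype κ := FiniteDimensional.fintypeBasisIndex c
  have hcard : Fintype.card κ = finrank K V := by
    rw [← Subspace.dual_finrank_eq, finrank_eq_card_basis c]
  let e : κ ≃ Fin (finrank K V) := Fintype.equivFinOfCardEq hcard
  let d := c.reindex e
  refine ⟨fun i => a (e.symm i), d.dualBasis.map (evalEquiv K V).symm, fun i => ?_⟩
  refine Basis.ext (d.dualBasis.map (evalEquiv K V).symm) fun j => ?_
  have h : d i = ev (a (e.symm i)) := by simp [d, c]
  rw [← h, Basis.map_apply, apply_evalEquiv_symm_apply, Basis.dualBasis_apply_self,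
    ← Basis.map_apply, Basis.coord_apply, Basis.repr_self, Finsupp.single_apply]
  simp only [eq_comm]

lemma Derivation.pow_apply_mul {R A : Type*} [CommRing R] [CommRing A] [Algebra R A]
    (D : Derivation R A A) (n : ℕ) (a b : A) :
    ((D : Module.End R A) ^ n) (a * b) = ∑ ij ∈ Finset.HasAntidiagonal.antidiagonal n,
      n.choose ij.1 • (((D : Module.End R A) ^ ij.1) a * ((D : Module.End R A) ^ ij.2) b) := by
  induction n with
  | zero => simp
  | succ n ih =>
    rw [Finset.sum_antidiagonal_choose_succ_nsmul
      (fun i j => ((D : Module.End R A) ^ i) a * ((D : Module.End R A) ^ j) b), pow_succ',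
      Module.End.mul_apply, ih, map_sum, ← Finset.sum_add_distrib]
    refine Finset.sum_congr rfl fun ij hij => ?_
    rw [map_nsmul, pow_succ' _ ij.1, pow_succ' _ ij.2]
    simp [Nat.choose_symm_of_eq_add (Finset.HasAntidiagonal.mem_antidiagonal.1 hij).symm]
    ring

lemma Derivation.exists_coe_eq_pow_prime {R A : Type*} [CommRing R] [CommRing A] [Algebra R A]
    (p : ℕ) [Fact p.Prime] [CharP A p] (D : Derivation R A A) :
    ∃ E : Derivation R A A, (E : Module.End R A) = (D : Module.End R A) ^ p := by
  refine ⟨Derivation.mk' ((D : Module.End R A) ^ p) fun a b => ?_, rfl⟩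
  obtain ⟨m, rfl⟩ : ∃ m, p = m + 1 :=
    Nat.exists_eq_succ_of_ne_zero (Fact.out : p.Prime).ne_zero
  obtain ⟨l, rfl⟩ : ∃ l, m = l + 1 :=
    Nat.exists_eq_succ_of_ne_zero (by rintro rfl; exact Nat.not_prime_one (Fact.out))
  rw [Derivation.pow_apply_mul, Finset.Nat.sum_antidiagonal_eq_sum_range_succ_mk,
    Finset.sum_range_succ, Finset.sum_range_succ', Finset.sum_eq_zero]
  · rw [zero_add]
    simp only [Nat.choose_self, Nat.choose_zero_right, one_smul, Nat.sub_self, Nat.sub_zero,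
      pow_zero, Module.End.one_apply, smul_eq_mul]
    ring
  · intro i hi
    have : ((l + 1 + 1).choose (i + 1) : A) = 0 := by
      rw [CharP.cast_eq_zero_iff A (l + 1 + 1)]
      exact (Fact.out : (l+1+1).Prime).dvd_choose_self (by simp) (by simpa using hi)
    rw [nsmul_eq_mul, this, zero_mul]

lemma MvPolynomial.derivation_aeval_eq_aeval_pderiv {C K σ : Type*} [Field C] [Field K]
    [Algebra C K] [DecidableEq σ] {x : σ → K} {i : σ} {E : Derivation C K K}
    (hE : ∀ j, E (x j) = if i = j then 1 else 0) (P : MvPolynomial σ C) :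
    E (aeval x P) = aeval x (pderiv i P) := by
  induction P using MvPolynomial.induction_on with
  | C a => simp
  | add P Q hP hQ => simp [hP, hQ]
  | mul_X P j hP =>
    simp only [map_mul, aeval_X, Derivation.leibniz, hE, hP, pderiv_X, smul_eq_mul, map_add,
      Pi.single_apply]
    rcases eq_or_ne i j with rfl | h
    · simp
    · simp [h, h.symm]

/-- A polynomial of degree less than `p` in each variable is determined by its value at a
system of coordinates of a field of characteristic `p`. -/
lemma MvPolynomial.eq_zero_of_aeval_coordinates_eq_zero {C K σ : Type*} [Field C] [Field K]
    [Algebra C K] [DecidableEq σ] (p : ℕ) [CharP C p] {x : σ → K}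
    {E : σ → Derivation C K K} (hE : ∀ i j, E i (x j) = if i = j then 1 else 0)
    (P : MvPolynomial σ C) (hdeg : ∀ m, coeff m P ≠ 0 → ∀ i, m i < p)
    (hP : aeval x P = 0) : P = 0 := by
  obtain ⟨N, hN⟩ : ∃ N, ∀ m, coeff m P ≠ 0 → m.degree < N :=
    ⟨P.support.sup Finsupp.degree + 1, fun m hm =>
      Nat.lt_succ_of_le (Finset.le_sup (f := Finsupp.degree) (mem_support_iff.2 hm))⟩
  induction N generalizing P with
  | zero =>
    ext m
    by_contra h
    exact absurd (hN m h) (Nat.not_lt_zero _)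
  | succ N ih =>
    have hcoeff : ∀ i m, coeff m (pderiv i P) ≠ 0 → coeff (m + Finsupp.single i 1) P ≠ 0 := by
      intro i m h h'
      simp [coeff_pderiv, h'] at h
    have hpd : ∀ i, pderiv i P = 0 := by
      intro i
      refine ih _ (fun m hm j => ?_) ?_ fun m hm => ?_
      · exact lt_of_le_of_lt (by simp) (hdeg _ (hcoeff i m hm) j)
      · rw [← derivation_aeval_eq_aeval_pderiv (hE i), hP, map_zero]
      · have := hN _ (hcoeff i m hm)
        simpa using this
    have hconst : ∀ m, m ≠ 0 → coeff m P = 0 := by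
      intro m hm
      obtain ⟨i, hi⟩ := DFunLike.ne_iff.1 hm
      by_contra hc
      have h := congrArg (coeff (m - Finsupp.single i 1)) (hpd i)
      have hle : Finsupp.single i 1 ≤ m := by
        simpa [Finsupp.single_le_iff, Nat.one_le_iff_ne_zero] using hi
      rw [coeff_pderiv, tsub_add_cancel_of_le hle, coeff_zero] at h
      rcases mul_eq_zero.1 h with h | h
      · exact hc h
      · have h1 : ((m i : ℕ) : C) = 0 := by
          rw [← h, ← Nat.cast_add_one]
          congr 1
          have : m i ≠ 0 := hi
          simp
          omega
        exact hi (Nat.eq_zero_of_dvd_of_lt ((CharP.cast_eq_zero_iff C p _).1 h1) (hdeg m hc i))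
    have hPC : P = MvPolynomial.C (coeff 0 P) := by
      ext m
      rw [coeff_C]
      split_ifs with h
      · rw [h]
      · exact hconst m (Ne.symm h)
    rw [hPC] at hP ⊢
    rw [aeval_C, map_eq_zero] at hP
    rw [hP, C_0]

lemma linearIndependent_coordinate_monomials {C K σ : Type*} [Field C] [Field K]
    [Algebra C K] [Fintype σ] [DecidableEq σ] (p : ℕ) [CharP C p] {x : σ → K}
    {E : σ → Derivation C K K} (hE : ∀ i j, E i (x j) = if i = j then 1 else 0) :
    LinearIndependent C fun a : σ → Fin p => ∏ i, x i ^ (a i : ℕ) := by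
  rw [Fintype.linearIndependent_iff]
  intro g hg
  let e : (σ → Fin p) → σ →₀ ℕ := fun a => Finsupp.equivFunOnFinite.symm fun i => (a i : ℕ)
  have he : Function.Injective e := by
    intro a b h
    funext i
    exact Fin.ext (DFunLike.congr_fun h i)
  let P : MvPolynomial σ C := ∑ a, MvPolynomial.monomial (e a) (g a)
  have hcoeff : ∀ m, P.coeff m = ∑ a, if e a = m then g a else 0 := by
    intro m
    simp [P, MvPolynomial.coeff_sum, MvPolynomial.coeff_monomial]
  have hP : P = 0 := by
    refine MvPolynomial.eq_zero_of_aeval_coordinates_eq_zero p hE P (fun m hm i => ?_) ?_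
    · rw [hcoeff] at hm
      obtain ⟨a, -, ha⟩ := Finset.exists_ne_zero_of_sum_ne_zero hm
      have : e a = m := by
        by_contra h
        exact ha (if_neg h)
      rw [← this]
      exact (a i).2
    · rw [← hg]
      simp only [P, map_sum, MvPolynomial.aeval_monomial, Algebra.smul_def]
      refine Finset.sum_congr rfl fun a _ => ?_
      rw [Finsupp.prod_fintype _ _ (by simp)]
      rfl
  intro a
  have := hcoeff (e a)
  rw [hP, MvPolynomial.coeff_zero] at this
  simpa [he.eq_iff] using this.symm

/-- Wronskian criterion: a family `f` which is linearly independent over the constants remains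
linearly independent over `K` after applying a stable family of differential operators. -/
lemma LinearIndependent.wronskian {C K ι α J : Type*} [Field C] [Field K] [Algebra C K]
    [Fintype J] (D : ι → Derivation C K K)
    (hconst : ∀ f : K, (∀ i, D i f = 0) → f ∈ Set.range (algebraMap C K))
    (T : α → Module.End C K) (hone : 1 ∈ Submodule.span C (Set.range T))
    (hmul : ∀ i a, (D i : Module.End C K) * T a ∈ Submodule.span C (Set.range T))
    {f : J → K} (hf : LinearIndependent C f) :
    LinearIndependent K fun j a => T a (f j) := by
  classical
  rw [Fintype.linearIndependent_iff]
  by_contra! hne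
  obtain ⟨g₀, hg₀, j₀, hj₀⟩ := hne
  let Rel : (J → K) → Prop := fun g => ∀ S ∈ Submodule.span C (Set.range T), ∑ j, g j * S (f j) = 0
  have hRel : ∀ g : J → K, (∀ a, ∑ j, g j * T a (f j) = 0) → Rel g := by
    intro g hg S hS
    induction hS using Submodule.span_induction with
    | mem S h => obtain ⟨a, rfl⟩ := h; exact hg a
    | zero => simp
    | add S S' _ _ h h' => simp [mul_add, Finset.sum_add_distrib, h, h']
    | smul c S _ h =>
      simp only [LinearMap.smul_apply, mul_smul_comm, ← Finset.smul_sum, h, smul_zero]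
  have hg₀' : Rel g₀ := hRel _ fun a => by simpa using congrFun hg₀ a
  have hderiv : ∀ g, Rel g → ∀ i, Rel fun j => D i (g j) := by
    intro g hg i
    refine hRel _ fun a => ?_
    have h1 := congrArg (D i) (hg (T a) (Submodule.subset_span ⟨a, rfl⟩))
    have h2 := hg _ (hmul i a)
    simp only [map_sum, Derivation.leibniz, smul_eq_mul, map_zero, Finset.sum_add_distrib] at h1
    simp only [Module.End.mul_apply, Derivation.coeFn_coe] at h2
    rw [h2, zero_add] at h1
    simpa only [mul_comm] using h1
  have key : ∀ N, ∀ g, Rel g → (Finset.univ.filter fun j => g j ≠ 0).card ≤ N → g = 0 := by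
    intro N
    induction N with
    | zero =>
      intro g _ hN
      funext j
      simpa using Finset.filter_eq_empty_iff.1 (Finset.card_eq_zero.1 (Nat.le_zero.1 hN))
        (Finset.mem_univ j)
    | succ N ih =>
      intro g hg hN
      by_contra hne
      obtain ⟨l, hl⟩ := Function.ne_iff.1 hne
      let h : J → K := fun j => (g l)⁻¹ * g j
      have hh : Rel h := by
        intro S hS
        simp only [h, mul_assoc, ← Finset.mul_sum, hg S hS, mul_zero]
      have hhl : h l = 1 := inv_mul_cancel₀ hl
      have hDh : ∀ i j, D i (h j) = 0 := by
        intro i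
        refine congrFun (ih _ (hderiv h hh i) (Nat.le_of_lt_succ (lt_of_lt_of_le ?_ hN)))
        refine Finset.card_lt_card ⟨fun j hj => ?_, fun hsub => ?_⟩
        · simp only [Finset.mem_filter, Finset.mem_univ, true_and] at hj ⊢
          intro h0
          exact hj (by simp [h, h0])
        · have := hsub (Finset.mem_filter.2 ⟨Finset.mem_univ l, hl⟩)
          simp [hhl] at this
      choose c hc using fun j => hconst (h j) fun i => hDh i j
      have := hh 1 hone
      simp only [← hc, Module.End.one_apply, ← Algebra.smul_def] at this
      have hcl := Fintype.linearIndependent_iff.1 hf c this l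
      rw [← hc, hcl, map_zero] at hhl
      exact zero_ne_one hhl
  exact hj₀ (congrFun (key _ g₀ hg₀' le_rfl) j₀)

lemma prod_pow_add_single {B ι : Type*} [CommMonoid B] [Fintype ι] [DecidableEq ι]
    (D : ι → B) (a : ι → ℕ) (l : ι) :
    ∏ j, D j ^ (a + Pi.single l 1 : ι → ℕ) j = (∏ j, D j ^ a j) * D l := by
  simp only [Pi.add_apply, pow_add, Finset.prod_mul_distrib]
  simp [Pi.single_apply, pow_ite]

lemma prod_pow_mem_span_small {C B ι : Type*} [Field C] [CommRing B] [Algebra C B]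
    [Fintype ι] [DecidableEq ι] {p : ℕ} (hp : 2 ≤ p) {D : ι → B}
    (hD : ∀ i, D i ^ p ∈ Submodule.span C (Set.range D)) (a : ι → ℕ) :
    ∏ i, D i ^ a i ∈
      Submodule.span C (Set.range fun b : ι → Fin p => ∏ i, D i ^ (b i : ℕ)) := by
  obtain ⟨N, hN⟩ : ∃ N, ∑ i, a i ≤ N := ⟨_, le_rfl⟩
  induction N using Nat.strong_induction_on generalizing a with
  | _ N ih =>
  by_cases h : ∀ i, a i < p
  · exact Submodule.subset_span ⟨fun i => ⟨a i, h i⟩, rfl⟩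
  push Not at h
  obtain ⟨i, hi⟩ := h
  let a' : ι → ℕ := Function.update a i (a i - p)
  have hsum : ∑ j, a j = ∑ j, a' j + p := by
    rw [← Finset.add_sum_erase _ _ (Finset.mem_univ i),
      ← Finset.add_sum_erase _ a' (Finset.mem_univ i)]
    have : ∑ j ∈ Finset.univ.erase i, a' j = ∑ j ∈ Finset.univ.erase i, a j :=
      Finset.sum_congr rfl fun j hj => Function.update_of_ne (Finset.ne_of_mem_erase hj) _ _
    rw [this]
    simp only [a', Function.update_self]
    omega
  have hprod : ∏ j, D j ^ a j = (∏ j, D j ^ a' j) * D i ^ p := by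
    rw [← Finset.mul_prod_erase _ _ (Finset.mem_univ i),
      ← Finset.mul_prod_erase _ (fun j => D j ^ a' j) (Finset.mem_univ i)]
    have : ∏ j ∈ Finset.univ.erase i, D j ^ a' j = ∏ j ∈ Finset.univ.erase i, D j ^ a j :=
      Finset.prod_congr rfl fun j hj => by
        simp only [a', Function.update_of_ne (Finset.ne_of_mem_erase hj)]
    rw [this]
    simp only [a', Function.update_self]
    rw [mul_right_comm, ← pow_add, Nat.sub_add_cancel hi]
  rw [hprod]
  have hmem := hD i
  generalize D i ^ p = y at hmem
  induction hmem using Submodule.span_induction with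
  | mem y hy =>
    obtain ⟨l, rfl⟩ := hy
    have : (∏ j, D j ^ a' j) * D l = ∏ j, D j ^ (a' + Pi.single l 1 : ι → ℕ) j :=
      (prod_pow_add_single D a' l).symm
    rw [this]
    have hs : ∑ j, (a' + Pi.single l 1 : ι → ℕ) j = ∑ j, a' j + 1 := by
      simp [Finset.sum_add_distrib]
    exact ih _ (by omega) _ hs.le
  | zero => simp
  | add y z _ _ hy hz => rw [mul_add]; exact add_mem hy hz
  | smul c y _ hy => rw [mul_smul_comm]; exact Submodule.smul_mem _ _ hy

open scoped IsMulCommutative in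
lemma exists_monomial_family_of_commute {C A ι : Type*} [Field C] [Ring A] [Algebra C A]
    [Fintype ι] {p : ℕ} (hp : 2 ≤ p) {D : ι → A} (hcomm : ∀ i j, Commute (D i) (D j))
    (hpow : ∀ i, D i ^ p ∈ Submodule.span C (Set.range D)) :
    ∃ T : (ι → Fin p) → A, 1 ∈ Submodule.span C (Set.range T) ∧
      ∀ i a, D i * T a ∈ Submodule.span C (Set.range T) := by
  classical
  have hB : IsMulCommutative (Algebra.adjoin C (Set.range D)) := by
    apply Algebra.isMulCommutative_adjoin
    rintro _ ⟨i, rfl⟩ _ ⟨j, rfl⟩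
    exact hcomm i j
  let φ := (Algebra.adjoin C (Set.range D)).val.toLinearMap
  let d : ι → Algebra.adjoin C (Set.range D) := fun i => ⟨D i, Algebra.subset_adjoin ⟨i, rfl⟩⟩
  have hspan : ∀ {α : Type _} (t : α → Algebra.adjoin C (Set.range D)),
      Submodule.span C (Set.range fun b => (t b : A)) =
        (Submodule.span C (Set.range t)).map φ := by
    intro α t
    rw [Submodule.map_span, ← Set.range_comp]
    rfl
  have hd : ∀ i, d i ^ p ∈ Submodule.span C (Set.range d) := by
    intro i
    have h := hpow i
    rw [show D = fun j => (d j : A) from rfl, hspan d] at h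
    obtain ⟨y, hy, hyd⟩ := h
    have : y = d i ^ p := Subtype.ext hyd
    rwa [← this]
  have ht := prod_pow_mem_span_small hp hd
  refine ⟨fun b => ((∏ i, d i ^ (b i : ℕ) : Algebra.adjoin C (Set.range D)) : A), ?_, ?_⟩
  · rw [hspan]
    exact ⟨_, ht 0, by simp [φ]⟩
  · intro i b
    rw [hspan]
    refine ⟨_, ht ((fun j => (b j : ℕ)) + Pi.single i 1), ?_⟩
    rw [prod_pow_add_single, mul_comm]
    rfl

theorem card_le_of_commuting_derivations {C K ι σ : Type*} [Field C] [Field K] [Algebra C K]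
    [Fintype ι] [Fintype σ] [DecidableEq σ] (p : ℕ) [Fact p.Prime] [CharP C p]
    (D : ι → Derivation C K K)
    (hcomm : ∀ i j, Commute (D i : Module.End C K) (D j : Module.End C K))
    (hpow : ∀ i, (D i : Module.End C K) ^ p ∈
      Submodule.span C (Set.range fun j => (D j : Module.End C K)))
    (hconst : ∀ f : K, (∀ i, D i f = 0) → f ∈ Set.range (algebraMap C K))
    {x : σ → K} {E : σ → Derivation C K K}
    (hE : ∀ i j, E i (x j) = if i = j then 1 else 0) :
    Fintype.card σ ≤ Fintype.card ι := by
  classical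
  have hp : p.Prime := Fact.out
  obtain ⟨T, hone, hmul⟩ := exists_monomial_family_of_commute hp.two_le hcomm hpow
  have hli := LinearIndependent.wronskian D hconst T hone hmul
    (linearIndependent_coordinate_monomials p hE)
  have hcard := hli.fintype_card_le_finrank
  simp only [Fintype.card_fun, Fintype.card_fin, finrank_fintype_fun_eq_card] at hcard
  exact (Nat.pow_le_pow_iff_right hp.one_lt).1 hcard

lemma Derivation.lie_smul_right {R A : Type*} [CommRing R] [CommRing A] [Algebra R A]
    (D E : Derivation R A A) (f : A) : ⁅D, f • E⁆ = f • ⁅D, E⁆ + D f • E := by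
  ext a
  simp only [Derivation.commutator_apply, Derivation.smul_apply, Derivation.add_apply,
    Derivation.leibniz, smul_eq_mul]
  ring

lemma Derivation.lie_eq_zero_iff_commute {R A : Type*} [CommRing R] [CommRing A] [Algebra R A]
    (D E : Derivation R A A) :
    ⁅D, E⁆ = 0 ↔ Commute (D : Module.End R A) (E : Module.End R A) := by
  rw [commute_iff_eq, Derivation.ext_iff, LinearMap.ext_iff]
  simp [Derivation.commutator_apply, sub_eq_zero]

/-- A derivation killing a subfield, regarded as a derivation over that subfield. -/
def Derivation.overSubfield {k K : Type*} [Field k] [Field K] [Algebra k K] (C : Subfield K)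
    (D : Derivation k K K) (hD : ∀ c ∈ C, D c = 0) : Derivation C K K :=
  Derivation.mk'
    { toFun := D
      map_add' := map_add D
      map_smul' := fun c f => by
        simp [Subfield.smul_def, hD c c.2] }
    fun a b => by simp

/-- The field of common constants of a set of derivations. -/
def Derivation.constants {k K : Type*} [Field k] [Field K] [Algebra k K]
    (S : Set (Derivation k K K)) : Subfield K where
  carrier := {f | ∀ D ∈ S, D f = 0}
  mul_mem' ha hb D hD := by simp [ha D hD, hb D hD]
  one_mem' D _ := by simp
  add_mem' ha hb D hD := by simp [ha D hD, hb D hD]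
  zero_mem' D _ := by simp
  neg_mem' ha D hD := by simp [ha D hD]
  inv_mem' a ha D hD := by simp [Derivation.leibniz_inv, ha D hD]

/-- Evaluation of derivations at a function. -/
def Derivation.evalDual (k : Type*) {K : Type*} [Field k] [Field K] [Algebra k K] (x : K) :
    Dual K (Derivation k K K) where
  toFun D := D x
  map_add' _ _ := rfl
  map_smul' _ _ := rfl

/-- An involutive space of derivations has a basis of commuting derivations. -/
lemma exists_commuting_basis_of_involutive {k K : Type*} [Field k] [Field K] [Algebra k K]
    (W : Submodule K (Derivation k K K)) [FiniteDimensional K W]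
    (hinv : ∀ u ∈ W, ∀ v ∈ W, ⁅u, v⁆ ∈ W) :
    ∃ b : Basis (Fin (finrank K W)) K W,
      ∀ i j, ⁅(b i : Derivation k K K), (b j : Derivation k K K)⁆ = 0 := by
  obtain ⟨x, b, hb⟩ := exists_basis_dual_to_separating_family
    (fun x => (Derivation.evalDual k x).domRestrict W)
    (fun v hv => Subtype.ext (Derivation.ext hv))
  have hx : ∀ (w : W) i, (w : Derivation k K K) (x i) = b.repr w i :=
    fun w i => LinearMap.congr_fun (hb i) w
  refine ⟨b, fun i j => ?_⟩
  have h : (⟨_, hinv _ (b i).2 _ (b j).2⟩ : W) = 0 := by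
    refine b.ext_elem fun l => ?_
    rw [← hx]
    simp only [Derivation.commutator_apply, hx, Basis.repr_self, Finsupp.single_apply]
    split_ifs <;> simp
  exact congrArg Subtype.val h

/-- A set of commuting derivations which is stable under `p`-th powers spans the space of all
derivations as soon as every derivation kills its constants. -/
theorem span_commuting_derivations_eq_top {k K : Type*} [Field k] [Field K] [Algebra k K]
    [FiniteDimensional K (Derivation k K K)] (p : ℕ) [Fact p.Prime] [CharP K p]
    {S : Set (Derivation k K K)} (hcomm : ∀ D ∈ S, ∀ E ∈ S, ⁅D, E⁆ = 0)
    (hpow : ∀ D ∈ S, ∃ E ∈ S, (E : Module.End k K) = (D : Module.End k K) ^ p)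
    (hconst : ∀ f : K, (∀ D ∈ S, D f = 0) → ∀ E : Derivation k K K, E f = 0) :
    Submodule.span K S = ⊤ := by
  classical
  obtain ⟨b, hbS, hspan, hli⟩ := exists_linearIndependent K S
  have : Finite b := hli.finite
  have : Fintype b := Fintype.ofFinite b
  let C := Derivation.constants S
  have hC : ∀ E : Derivation k K K, ∀ c ∈ C, E c = 0 := fun E c hc => hconst c hc E
  have : CharP C p := (algebraMap C K).charP (algebraMap C K).injective p
  let lift : Derivation k K K → Derivation C K K := fun D => D.overSubfield C (hC D)
  have hlift : ∀ D f, lift D f = D f := fun _ _ => rfl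
  have hcommS : ∀ D ∈ S, ∀ E ∈ S, ∀ f, D (E f) = E (D f) := by
    intro D hD E hE f
    have := Derivation.congr_fun (hcomm D hD E hE) f
    rwa [Derivation.commutator_apply, Derivation.zero_apply, sub_eq_zero] at this
  obtain ⟨x, B, hB⟩ := exists_basis_dual_to_separating_family
    (fun x : K => Derivation.evalDual k x) (fun v hv => Derivation.ext hv)
  have hcard := card_le_of_commuting_derivations p (fun D : b => lift D)
    (fun D E => LinearMap.ext fun f => hcommS D (hbS D.2) E (hbS E.2) f) ?_ ?_
    (E := fun i => lift (B i)) (x := x) ?_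
  · rw [Fintype.card_fin] at hcard
    rw [← hspan]
    have := hli.span_eq_top_of_card_eq_finrank'
      (le_antisymm hli.fintype_card_le_finrank hcard)
    rwa [Subtype.range_coe] at this
  · intro D
    obtain ⟨E, hES, hE⟩ := hpow D (hbS D.2)
    have hEb : E ∈ Submodule.span K (Set.range ((↑) : b → Derivation k K K)) := by
      rw [Subtype.range_coe, hspan]
      exact Submodule.subset_span hES
    obtain ⟨c, hc⟩ := (Submodule.mem_span_range_iff_exists_fun K).1 hEb
    have hcC : ∀ j, c j ∈ C := by
      intro j F hF
      have h := hcomm F hF E hES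
      rw [← hc, lie_sum] at h
      simp only [Derivation.lie_smul_right] at h
      refine Fintype.linearIndependent_iff.1 hli (fun j => F (c j)) ?_ j
      rw [← h]
      refine Finset.sum_congr rfl fun l _ => ?_
      rw [hcomm F hF l (hbS l.2), smul_zero, zero_add]
    refine (Submodule.mem_span_range_iff_exists_fun C).2 ⟨fun j => ⟨c j, hcC j⟩, ?_⟩
    refine LinearMap.ext fun f => ?_
    have h1 := LinearMap.congr_fun hE f
    rw [Module.End.pow_apply, ← hc] at h1
    rw [Module.End.pow_apply]
    refine Eq.trans ?_ h1
    have h2 := map_sum (Derivation.evalDual k f) (fun j : b => c j • (j : Derivation k K K)) .univ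
    refine Eq.trans ?_ h2.symm
    simp [hlift, Subfield.smul_def, Derivation.evalDual]
  · intro f hf
    refine ⟨⟨f, fun D hD => ?_⟩, rfl⟩
    have hle : Submodule.span K S ≤ LinearMap.ker (Derivation.evalDual k f) := by
      rw [← hspan, Submodule.span_le]
      exact fun D hD => hf ⟨D, hD⟩
    exact hle (Submodule.subset_span hD)
  · intro i j
    have : B i (x j) = B.repr (B i) j := LinearMap.congr_fun (hB j) (B i)
    rw [hlift, this, Basis.repr_self, Finsupp.single_apply]

/-- A linear form on derivations which is constant on a commuting basis satisfies Cartan's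
closedness condition. -/
lemma cartan_of_const_on_commuting_basis {k K ι : Type*} [Field k] [Field K] [Algebra k K]
    (b : Basis ι K (Derivation k K K)) (hcomm : ∀ i j, ⁅b i, b j⁆ = 0)
    (c : Dual K (Derivation k K K)) (hc : ∀ i (D : Derivation k K K), D (c (b i)) = 0)
    (u v : Derivation k K K) : u (c v) - v (c u) = c ⁅u, v⁆ := by
  have hu : u ∈ Submodule.span K (Set.range b) := by rw [b.span_eq]; trivial
  have hv : v ∈ Submodule.span K (Set.range b) := by rw [b.span_eq]; trivial
  induction hu using Submodule.span_induction with
  | zero => simp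
  | add u u' _ _ h h' =>
    rw [add_lie, map_add c ⁅u, v⁆, ← h, ← h', map_add c u, map_add, Derivation.add_apply]
    ring
  | smul f u _ h =>
    rw [← lie_skew, Derivation.lie_smul_right, neg_add, ← smul_neg, lie_skew]
    simp only [map_add, map_smul, map_neg, ← h, Derivation.smul_apply, smul_eq_mul,
      Derivation.leibniz]
    ring
  | mem u hu =>
    obtain ⟨i, rfl⟩ := hu
    induction hv using Submodule.span_induction with
    | zero => simp
    | add v v' _ _ h h' =>
      rw [lie_add, map_add c ⁅b i, v⁆, ← h, ← h', map_add c v, map_add, Derivation.add_apply]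
      ring
    | smul f v _ h =>
      simp only [Derivation.lie_smul_right, map_add, map_smul, ← h, Derivation.smul_apply,
        smul_eq_mul, Derivation.leibniz]
      ring
    | mem v hv =>
      obtain ⟨j, rfl⟩ := hv
      simp [hc, hcomm]

lemma exists_oneForm_eq_dual {k K : Type*} [Field k] [Field K] [Algebra k K]
    [FiniteDimensional K (Derivation k K K)] (c : Dual K (Derivation k K K)) :
    ∃ ω : Ω[K⁄k], ∀ u : Derivation k K K, u.liftKaehlerDifferential ω = c u := by
  let L := KaehlerDifferential.linearMapEquivDerivation k K (M := K)
  have : FiniteDimensional K (Dual K Ω[K⁄k]) := L.symm.finiteDimensional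
  have : FiniteDimensional K Ω[K⁄k] := (finite_dual_iff K).1 this
  refine ⟨(evalEquiv K Ω[K⁄k]).symm (c ∘ₗ L.toLinearMap), fun u => ?_⟩
  have h := apply_evalEquiv_symm_apply K Ω[K⁄k] (L.symm u) (c ∘ₗ L.toLinearMap)
  rw [LinearMap.comp_apply, LinearEquiv.coe_coe, L.apply_symm_apply] at h
  exact h

lemma prod_ι_ne_zero_of_dual_family {K M : Type*} [Field K] [AddCommGroup M] [Module K M]
    {q : ℕ} (ω : Fin q → M) (u : Fin q → Dual K M)
    (h : ∀ i j, u j (ω i) = if i = j then 1 else 0) :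
    (List.ofFn fun i => ExteriorAlgebra.ι K (ω i)).prod ≠ 0 := by
  intro h0
  rw [← ExteriorAlgebra.ιMulti_apply] at h0
  have h1 : exteriorPower.ιMulti K q ω = 0 := Subtype.ext h0
  have h2 := exteriorPower.pairingDual_ιMulti_ιMulti u ω
  have h3 : (Matrix.of fun i j => u j (ω i)) = 1 := by
    ext i j
    simp [h, Matrix.one_apply]
  rw [h1, map_zero, h3, Matrix.det_one] at h2
  exact zero_ne_one h2

end Derivations

theorem p_dense_foliation_defined_by_closed_rational_one_forms
    (p : ℕ) [Fact p.Prime]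
    (k : Type) [Field k] [IsAlgClosed k] [CharP k p]
    -- `K` is the function field of the smooth algebraic variety `X` over `k`:
    (K : Type) [Field K] [Algebra k K]
    (hfg : ∃ s : Finset K, IntermediateField.adjoin k (s : Set K) = ⊤)
    (hfd : FiniteDimensional K (Derivation k K K))
    -- the foliation `F`: an involutive `K`-submodule `W = T_F` of the
    -- rational vector fields of `X`
    (W : Submodule K (Derivation k K K))
    (hinv : ∀ u ∈ W, ∀ v ∈ W, ⁅u, v⁆ ∈ W)
    -- `F` has codimension `q ≥ 1`
    (q : ℕ) (hq : 1 ≤ q)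
    (hcodim : Module.finrank K ((Derivation k K K) ⧸ W) = q)
    -- `F` is `p`-dense: every rational first integral has vanishing differential
    (hpdense : ∀ f : K, (∀ D ∈ W, D f = 0) → KaehlerDifferential.D k K f = 0) :
    -- conclusion: closed rational 1-forms `ω₁, …, ω_q` vanishing on `T_F`
    -- whose wedge product is nonzero
    ∃ ω : Fin q → Ω[K⁄k],
      (∀ i, IsClosedRationalOneForm k K (ω i)) ∧
      (∀ i, ∀ v ∈ W, Derivation.liftKaehlerDifferential v (ω i) = 0) ∧
      (List.ofFn fun i => ExteriorAlgebra.ι K (ω i)).prod ≠ 0 := by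
  classical
  have : CharP K p := charP_of_injective_algebraMap (algebraMap k K).injective p
  obtain ⟨v, hv⟩ := exists_commuting_basis_of_involutive W hinv
  let v' : Fin (Module.finrank K W) → Derivation k K K := fun i => v i
  have hv'li : LinearIndependent K v' := v.linearIndependent.map' W.subtype W.ker_subtype
  let S : Set (Derivation k K K) :=
    {D | ∃ i m, (D : Module.End k K) = (v' i : Module.End k K) ^ p ^ m}
  have hvS : Set.range v' ⊆ S := by
    rintro _ ⟨i, rfl⟩
    exact ⟨i, 0, by simp⟩
  have hcomm : ∀ D ∈ S, ∀ E ∈ S, ⁅D, E⁆ = 0 := by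
    rintro D ⟨i, m, hD⟩ E ⟨j, l, hE⟩
    rw [Derivation.lie_eq_zero_iff_commute, hD, hE]
    exact ((Derivation.lie_eq_zero_iff_commute _ _).1 (hv i j)).pow_pow _ _
  have hpow : ∀ D ∈ S, ∃ E ∈ S, (E : Module.End k K) = (D : Module.End k K) ^ p := by
    rintro D ⟨i, m, hD⟩
    obtain ⟨E, hE⟩ := D.exists_coe_eq_pow_prime p
    exact ⟨E, ⟨i, m + 1, by rw [hE, hD, ← pow_mul, pow_succ]⟩, hE⟩
  have hspanv : Submodule.span K (Set.range v') = W := by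
    have h := congrArg (Submodule.map W.subtype) v.span_eq
    rw [Submodule.map_span, ← Set.range_comp, Submodule.map_subtype_top] at h
    exact h
  have hconst : ∀ f : K, (∀ D ∈ S, D f = 0) → ∀ E : Derivation k K K, E f = 0 := by
    intro f hf E
    have hd : KaehlerDifferential.D k K f = 0 := by
      refine hpdense f fun D hD => ?_
      have hle : W ≤ LinearMap.ker (Derivation.evalDual k f) := by
        rw [← hspanv, Submodule.span_le]
        exact fun D hD => hf D (hvS hD)
      exact hle hD
    rw [← E.liftKaehlerDifferential_comp_D, hd, map_zero]
  have htop := span_commuting_derivations_eq_top p hcomm hpow hconst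
  obtain ⟨b, hbS, hvb, hSb, hbli⟩ := exists_linearIndepOn_id_extension hv'li.linearIndepOn_id hvS
  let β : Module.Basis b K (Derivation k K K) := Module.Basis.mk hbli (by
    rw [← htop, Submodule.span_le]
    simpa using hSb)
  have hβ : ∀ i, β i = i := fun i => by simp [β]
  have : Finite b := Module.Finite.finite_basis β
  have hbcard : b.ncard = Module.finrank K (Derivation k K K) := by
    rw [Module.finrank_eq_nat_card_basis β]
    rfl
  have hvcard : (Set.range v').ncard = Module.finrank K W := by
    rw [← Set.image_univ, Set.ncard_image_of_injective _ hv'li.injective, Set.ncard_univ,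
      Nat.card_fin]
  have hq' : Nat.card ↥(b \ Set.range v') = q := by
    have h1 := Submodule.finrank_quotient_add_finrank W
    have h2 := Set.ncard_sdiff_add_ncard_of_subset hvb (Set.toFinite b)
    change (b \ Set.range v').ncard = q
    omega
  have : Finite ↥(b \ Set.range v') := ((Set.toFinite b).subset Set.sdiff_subset).to_subtype
  let e : Fin q ≃ ↥(b \ Set.range v') := (Finite.equivFinOfCardEq hq').symm
  let r : Fin q → b := fun i => ⟨e i, (e i).2.1⟩
  have hr : Function.Injective r := fun i j h => by
    have h' : (e i : Derivation k K K) = e j :=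
      congrArg (fun y : b => (y : Derivation k K K)) h
    exact e.injective (Subtype.ext h')
  choose ω hω using fun i => exists_oneForm_eq_dual (β.coord (r i))
  refine ⟨ω, fun i u w => ?_, fun i w hw => ?_, ?_⟩
  · rw [hω, hω, hω]
    refine cartan_of_const_on_commuting_basis β (fun i j => ?_) _ (fun j D => ?_) u w
    · rw [hβ, hβ]
      exact hcomm _ (hbS i.2) _ (hbS j.2)
    · rw [Module.Basis.coord_apply, Module.Basis.repr_self, Finsupp.single_apply]
      split_ifs <;> simp
  · rw [hω]
    have hle : W ≤ LinearMap.ker (β.coord (r i)) := by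
      rw [← hspanv, Submodule.span_le]
      intro D hD
      have hne : (⟨D, hvb hD⟩ : b) ≠ r i := by
        intro h
        have : D = e i := congrArg Subtype.val h
        exact (e i).2.2 (this ▸ hD)
      have h : β ⟨D, hvb hD⟩ = D := hβ _
      change β.coord (r i) D = 0
      rw [← h, Module.Basis.coord_apply, Module.Basis.repr_self, Finsupp.single_apply, if_neg hne]
    exact hle hw
  · refine prod_ι_ne_zero_of_dual_family ω
      (fun j => (β (r j)).liftKaehlerDifferential) fun i j => ?_
    rw [hω, Module.Basis.coord_apply, Module.Basis.repr_self, Finsupp.single_apply]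
    simp only [hr.eq_iff, eq_comm]
end

section
/- Let F be a p-dense foliation on a smooth algebraic variety X over an algebraically closed field of characteristic p > 0. Then the morphism ker ψ_F → Ω¹_X ⊗ (Frob* T_F / ker ψ_F) induced by the canonical connection ∇^can on Frob* T_F is zero; consequently, there exists a distribution F_p contained in F such that ker ψ_F = Frob* T_{F_p}. -/
open scoped TensorProduct

/-!
# Statement 2 (Lemma "L:kernel pcurvature")

Let `F` be a `p`-dense foliation on a smooth algebraic variety `X` over an
algebraically closed field of characteristic `p > 0`.  Then the morphism
`ker ψ_F → Ω¹_X ⊗ (Frob^* T_F / ker ψ_F)` induced by the canonical connection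
`∇^can` on `Frob^* T_F` is zero; consequently there is a distribution `F_p`
contained in `F` with `ker ψ_F = Frob^* T_{F_p}`.

We use the birational model of `X`: its function field `K` over `k`;
rational vector fields are derivations `Der_k(K)`, rational `1`-forms are the
Kähler differentials `Ω[K⁄k]`, and the foliation is its generic data, an
involutive `K`-subspace `W = T_F ⊆ Der_k(K)`.  `p`-th powers of vector fields
are taken in the associative algebra `End_k(K)`, and `N_F = T_X/T_F` is
modelled by `End_k(K)/W^lin`, `W^lin` being the `K`-span of `W` in `End_k(K)`.
The Frobenius pull-back `Frob^* M` of a `K`-module `M` is the base change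
`K ⊗_{K, Frob} M` of `M` along the Frobenius `Frob : K → K`, `x ↦ x^p`
(so that `1 ⊗ f·m = f^p ⊗ m`).  The `p`-curvature `ψ_F` and the canonical
connection `∇^can` are characterised by their values `ψ_F(f ⊗ v) = f•v^p
mod T_F` and `∇^can(f ⊗ v) = df ⊗ (1 ⊗ v)` on generators.
-/

/-- `K` viewed as an algebra over itself via the Frobenius `x ↦ x^p`. -/
def FrobTwist (p : ℕ) (K : Type*) : Type _ := K

instance FrobTwist.instField (p : ℕ) (K : Type*) [Field K] :
    Field (FrobTwist p K) := ‹Field K›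

/-- The algebra structure on `K` over `FrobTwist p K = K` given by the
Frobenius endomorphism. -/
noncomputable instance FrobTwist.instAlgebra (p : ℕ) [Fact p.Prime]
    (K : Type*) [Field K] [CharP K p] : Algebra (FrobTwist p K) K :=
  RingHom.toAlgebra (frobenius K p : K →+* K)

instance FrobTwist.instSMulCommClass (p : ℕ) [Fact p.Prime]
    (K : Type*) [Field K] [CharP K p] : SMulCommClass (FrobTwist p K) K K :=
  ⟨fun a b c => by
    show algebraMap (FrobTwist p K) K a * (b * c) = b * (algebraMap (FrobTwist p K) K a * c)
    ring⟩

/-- A `K`-module `M` viewed as a module over `FrobTwist p K = K` (via the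
identity, i.e. the untwisted action); used as the right factor of the
Frobenius base change `K ⊗_{K,Frob} M`. -/
def UnFrob (p : ℕ) (M : Type*) : Type _ := M

instance UnFrob.instAddCommGroup (p : ℕ) (M : Type*) [AddCommGroup M] :
    AddCommGroup (UnFrob p M) := ‹AddCommGroup M›

instance UnFrob.instModule (p : ℕ) (K M : Type*) [Field K] [AddCommGroup M]
    [Module K M] : Module (FrobTwist p K) (UnFrob p M) := ‹Module K M›

/-- The identity map into the untwisted right factor. -/
def toUnFrob (p : ℕ) {M : Type*} (m : M) : UnFrob p M := m

/-- The Frobenius pull-back `Frob^* M = K ⊗_{K, Frob} M` of a `K`-module. -/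
noncomputable def FrobPullback (p : ℕ) [Fact p.Prime] (K : Type*) [Field K]
    [CharP K p] (M : Type*) [AddCommGroup M] [Module K M] : Type _ :=
  TensorProduct (FrobTwist p K) K (UnFrob p M)

noncomputable instance FrobPullback.instAddCommGroup (p : ℕ) [Fact p.Prime]
    (K : Type*) [Field K] [CharP K p] (M : Type*) [AddCommGroup M] [Module K M] :
    AddCommGroup (FrobPullback p K M) :=
  inferInstanceAs (AddCommGroup (TensorProduct (FrobTwist p K) K (UnFrob p M)))

noncomputable instance FrobPullback.instModule (p : ℕ) [Fact p.Prime]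
    (K : Type*) [Field K] [CharP K p] (M : Type*) [AddCommGroup M] [Module K M] :
    Module K (FrobPullback p K M) :=
  inferInstanceAs (Module K (TensorProduct (FrobTwist p K) K (UnFrob p M)))

/-- The `K`-span, inside the `k`-linear endomorphisms of `K`, of the linear
maps underlying a family `W` of derivations: the generic model of the
subsheaf `T_F ⊆ T_X` (its quotient models `N_F = T_X/T_F`). -/
def tangentEnd (k K : Type*) [CommRing k] [CommRing K] [Algebra k K]
    (W : Submodule K (Derivation k K K)) : Submodule K (Module.End k K) :=
  Submodule.span K {φ : Module.End k K | ∃ D ∈ W, Derivation.toLinearMap D = φ}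

open IntermediateField Polynomial in
theorem finrank_adjoin_simple_of_pow_mem {p : ℕ} [Fact p.Prime] {L K : Type*} [Field L] [Field K]
    [Algebra L K] [CharP K p] {g : K} (hg : g ∉ (algebraMap L K).range)
    (hgp : g ^ p ∈ (algebraMap L K).range) : Module.finrank L L⟮g⟯ = p := by
  obtain ⟨a, ha⟩ := hgp
  have hirr : Irreducible (X ^ p - C a : L[X]) := by
    refine X_pow_sub_C_irreducible_of_prime Fact.out fun b hb => hg ⟨b, ?_⟩
    apply frobenius_inj K p
    simp [frobenius_def, ← map_pow, hb, ha]
  have hmin := minpoly.eq_of_irreducible_of_monic hirr (x := g) (by simp [ha])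
    (monic_X_pow_sub_C a (Fact.out : p.Prime).ne_zero)
  have hint : IsIntegral L g :=
    ⟨_, monic_X_pow_sub_C a (Fact.out : p.Prime).ne_zero, by simp [ha]⟩
  rw [IntermediateField.adjoin.finrank hint, ← hmin, natDegree_X_pow_sub_C]

/-- An intermediate field avoiding `f` lies in a maximal one avoiding `f`. -/
theorem exists_maximal_intermediateField_notMem {k K : Type*} [Field k] [Field K] [Algebra k K]
    (E : IntermediateField k K) {f : K} (hf : f ∉ E) :
    ∃ L : IntermediateField k K, E ≤ L ∧ Maximal (fun L => f ∉ L) L := by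
  refine zorn_le_nonempty₀ {L : IntermediateField k K | f ∉ L} (fun c hc hchain y hy => ?_) E hf
  refine ⟨sSup c, fun hfc => ?_, fun z hz => le_sSup hz⟩
  obtain ⟨M, hM, hfM⟩ := (CompleteLattice.isCompactElement_iff_le_of_directed_sSup_le _ _).1
    (IntermediateField.adjoin_simple_isCompactElement (F := k) f) c ⟨y, hy⟩ hchain.directedOn
    (by simpa using hfc)
  exact hc hM (by simpa using hfM)

open IntermediateField Polynomial in
/-- Over a perfect field of characteristic `p`, functions with zero differential are `p`-th powers. -/
theorem exists_pow_eq_of_D_eq_zero (p : ℕ) [Fact p.Prime] {k K : Type*} [Field k]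
    [CharP k p] [PerfectField k] [Field K] [Algebra k K] [CharP K p] {f : K}
    (hf : KaehlerDifferential.D k K f = 0) : ∃ g : K, g ^ p = f := by
  by_contra hnot
  have : PerfectRing k p := PerfectField.toPerfectRing p
  let E : IntermediateField k K :=
    { (frobenius K p).fieldRange with
      algebraMap_mem' := fun a => by
        obtain ⟨b, rfl⟩ := surjective_frobenius k p a
        exact ⟨algebraMap k K b, by simp [frobenius_def]⟩ }
  have hE (g : K) : g ^ p ∈ E := ⟨g, rfl⟩
  obtain ⟨L, hEL, hfL, hmax⟩ := exists_maximal_intermediateField_notMem E (f := f)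
    (fun ⟨g, hg⟩ => hnot ⟨g, hg⟩)
  have hrange (g : K) : g ∈ (algebraMap L K).range ↔ g ∈ L :=
    ⟨fun ⟨a, ha⟩ => ha ▸ a.2, fun h => ⟨⟨g, h⟩, rfl⟩⟩
  have hpow (g : K) : g ^ p ∈ (algebraMap L K).range := (hrange _).2 (hEL (hE g))
  have hint (g : K) : IsIntegral L g := by
    obtain ⟨a, ha⟩ := hpow g
    exact ⟨_, monic_X_pow_sub_C a (Fact.out : p.Prime).ne_zero, by simp [ha]⟩
  have htop : L⟮f⟯ = ⊤ := by
    refine eq_top_iff.2 fun g _ => ?_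
    by_cases hg : g ∈ L
    · exact IntermediateField.algebraMap_mem L⟮f⟯ (⟨g, hg⟩ : L)
    have hfg : f ∈ L⟮g⟯ := by
      by_contra hfg
      exact hg (hmax (y := restrictScalars k L⟮g⟯) hfg
        (fun x hx => IntermediateField.algebraMap_mem L⟮g⟯ (⟨x, hx⟩ : L)) (mem_adjoin_simple_self L g))
    have := adjoin.finiteDimensional (hint g)
    rw [IntermediateField.eq_of_le_of_finrank_eq (adjoin_simple_le_iff.2 hfg)
      (by rw [finrank_adjoin_simple_of_pow_mem (mt (hrange g).1 hg) (hpow g),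
        finrank_adjoin_simple_of_pow_mem (mt (hrange f).1 hfL) (hpow f)])]
    exact mem_adjoin_simple_self L g
  have hadj : Algebra.adjoin L {f} = ⊤ := by
    rw [← adjoin_simple_toSubalgebra_of_isAlgebraic (hint f).isAlgebraic, htop, top_toSubalgebra]
  have hDf : KaehlerDifferential.D L K f = 0 := by
    have := congrArg
      ((KaehlerDifferential.D L K).restrictScalars k).liftKaehlerDifferential hf
    simpa using this
  have hunr : Algebra.FormallyUnramified L K := by
    refine ⟨subsingleton_of_forall_eq 0 fun x => ?_⟩
    have hD : KaehlerDifferential.D L K = 0 := by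
      ext g
      refine Derivation.eqOn_adjoin (D2 := 0) (s := {f}) (by simpa [Set.EqOn] using hDf) ?_
      rw [hadj]; trivial
    have hx : x ∈ Submodule.span K (Set.range (KaehlerDifferential.D L K)) := by
      rw [KaehlerDifferential.span_range_derivation]; trivial
    simpa [hD] using hx
  have hfin : FiniteDimensional L K := by
    have := adjoin.finiteDimensional (hint f)
    rw [htop] at this
    exact .of_surjective (IntermediateField.topEquiv (F := L) (E := K)).toLinearMap
      (IntermediateField.topEquiv (F := L) (E := K)).surjective
  have : IsPurelyInseparable L K :=
    (isPurelyInseparable_iff_pow_mem L p).2 fun x => ⟨1, by simpa using hpow x⟩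
  have := Algebra.FormallyUnramified.range_eq_top_of_isPurelyInseparable L K
  exact hfL ((hrange f).1 (this ▸ trivial))

/-- A subspace of `K^ι` stable under coordinatewise application of a family of additive maps
killing `1` is spanned by its vectors with constant coordinates. -/
theorem Submodule.le_span_setOf_forall_apply_eq_zero {K ι : Type*} [Field K]
    (N : Submodule K (ι →₀ K)) (S : Set (K →+ K)) (hone : ∀ δ ∈ S, δ 1 = 0)
    (hN : ∀ δ ∈ S, ∀ x ∈ N, Finsupp.mapRange.addMonoidHom δ x ∈ N) :
    N ≤ Submodule.span K {y | y ∈ N ∧ ∀ δ ∈ S, ∀ i, δ (y i) = 0} := by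
  intro x hx
  induction hn : x.support.card using Nat.strong_induction_on generalizing x with
  | _ n ih =>
  subst hn
  by_cases hx0 : x = 0
  · simp [hx0]
  obtain ⟨i, hi⟩ := Finsupp.ne_iff.1 hx0
  rw [Finsupp.zero_apply] at hi
  have hyN : (x i)⁻¹ • x ∈ N := N.smul_mem _ hx
  by_cases hconst : ∀ δ ∈ S, ∀ j, δ (((x i)⁻¹ • x) j) = 0
  · rw [← smul_inv_smul₀ hi x]
    exact Submodule.smul_mem _ _ (Submodule.subset_span ⟨hyN, hconst⟩)
  push Not at hconst
  obtain ⟨δ, hδ, j, hj⟩ := hconst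
  obtain ⟨z, hzN, hzapp⟩ : ∃ z ∈ N, ∀ l, z l = δ ((x i)⁻¹ * x l) :=
    ⟨_, hN δ hδ _ hyN, fun l => by simp⟩
  have hzj : z j ≠ 0 := by simpa [hzapp] using hj
  have hzx (l : ι) (hl : x l = 0) : z l = 0 := by simp [hzapp, hl]
  have hxj : x j ≠ 0 := fun h => hzj (hzx j h)
  have hzmem := ih _ (Finset.card_lt_card (Finset.ssubset_iff_of_subset (fun l hl => by
    simp only [Finsupp.mem_support_iff] at hl ⊢
    exact fun h => hl (hzx l h)) |>.2 ⟨i, by simpa using hi, by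
      simp [hzapp, hi, hone δ hδ]⟩)) hzN rfl
  have hwmem := ih _ (Finset.card_lt_card (Finset.ssubset_iff_of_subset (fun l hl => by
    simp only [Finsupp.mem_support_iff] at hl ⊢
    exact fun h => hl (by simp [h, hzx l h])) |>.2 ⟨j, by simpa using hxj, by
      simp [hzj]⟩)) (N.sub_mem hx (N.smul_mem (x j / z j) hzN)) rfl
  have := Submodule.add_mem _ hwmem (Submodule.smul_mem _ (x j / z j) hzmem)
  rwa [sub_add_cancel] at this

section tangentEnd

attribute [local instance] LieRing.ofAssociativeRing

/-- Jacobson's identity `ad (v ^ p) = (ad v) ^ p` in characteristic `p`. -/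
theorem ad_pow_char_apply (k : Type*) {A : Type*} [Field k] [Ring A] [Algebra k A]
    (p : ℕ) [Fact p.Prime] [CharP k p] (u v : A) :
    ⁅v ^ p, u⁆ = (LieAlgebra.ad k A v ^ p) u := by
  nontriviality A
  have : CharP (Module.End k A) p := charP_of_injective_algebraMap (algebraMap k _).injective p
  have : ExpChar (Module.End k A) p := .prime Fact.out
  have had : LieAlgebra.ad k A v = LinearMap.mulLeft k v - LinearMap.mulRight k v :=
    congr_fun (LieAlgebra.ad_eq_lmul_left_sub_lmul_right A) v
  rw [had, sub_pow_expChar_of_commute p (LinearMap.commute_mulLeft_right v v)]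
  simp [LinearMap.pow_mulLeft, LinearMap.pow_mulRight, Ring.lie_def]

variable {k K : Type*} [Field k] [Field K] [Algebra k K] {W : Submodule K (Derivation k K K)}

theorem mem_tangentEnd {φ : Module.End k K} :
    φ ∈ tangentEnd k K W ↔ ∃ D ∈ W, Derivation.toLinearMap D = φ := by
  refine ⟨fun h => ?_, fun h => Submodule.subset_span h⟩
  induction h using Submodule.span_induction with
  | mem x h => exact h
  | zero => exact ⟨0, W.zero_mem, rfl⟩
  | add x y _ _ hx hy =>
    obtain ⟨D, hD, rfl⟩ := hx
    obtain ⟨E, hE, rfl⟩ := hy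
    exact ⟨D + E, W.add_mem hD hE, rfl⟩
  | smul a x _ hx =>
    obtain ⟨D, hD, rfl⟩ := hx
    exact ⟨a • D, W.smul_mem a hD, rfl⟩

theorem lie_mem_tangentEnd (hinv : ∀ u ∈ W, ∀ v ∈ W, ⁅u, v⁆ ∈ W)
    {φ χ : Module.End k K} (hφ : φ ∈ tangentEnd k K W)
    (hχ : χ ∈ tangentEnd k K W) : ⁅φ, χ⁆ ∈ tangentEnd k K W := by
  obtain ⟨D, hD, rfl⟩ := mem_tangentEnd.1 hφ
  obtain ⟨E, hE, rfl⟩ := mem_tangentEnd.1 hχ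
  exact mem_tangentEnd.2 ⟨⁅D, E⁆, hinv D hD E hE, rfl⟩

theorem lie_pow_char_mem_tangentEnd (hinv : ∀ u ∈ W, ∀ v ∈ W, ⁅u, v⁆ ∈ W)
    (p : ℕ) [Fact p.Prime] [CharP k p] {φ χ : Module.End k K}
    (hφ : φ ∈ tangentEnd k K W) (hχ : χ ∈ tangentEnd k K W) :
    ⁅φ, χ ^ p⁆ ∈ tangentEnd k K W := by
  rw [← lie_skew, ad_pow_char_apply k p]
  refine neg_mem ?_
  induction p with
  | zero => simpa using hφ
  | succ n ih =>
    rw [pow_succ']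
    exact lie_mem_tangentEnd hinv hχ ih

/-- The kernel of a linear map with the values of the `p`-curvature on a basis is stable under
the connection with constant basis vectors, in the directions tangent to `W`. -/
theorem mapRange_mem_ker_pCurvature (hinv : ∀ u ∈ W, ∀ v ∈ W, ⁅u, v⁆ ∈ W)
    (p : ℕ) [Fact p.Prime] [CharP k p] {ι : Type*} {v : ι → W}
    {Θ : (ι →₀ K) →ₗ[K] (Module.End k K ⧸ tangentEnd k K W)}
    (hΘ : ∀ i a, Θ (Finsupp.single i a) =
      (tangentEnd k K W).mkQ (a • ((Derivation.toLinearMap (v i).val : Module.End k K) ^ p)))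
    {u : Derivation k K K} (hu : u ∈ W) {x : ι →₀ K} (hx : x ∈ LinearMap.ker Θ) :
    Finsupp.mapRange.addMonoidHom (u : K →+ K) x ∈ LinearMap.ker Θ := by
  have hlift : ∃ φ : Module.End k K, (tangentEnd k K W).mkQ φ = Θ x ∧
      (tangentEnd k K W).mkQ ⁅Derivation.toLinearMap u, φ⁆ =
        Θ (Finsupp.mapRange.addMonoidHom (u : K →+ K) x) := by
    clear hx
    induction x using Finsupp.induction_linear with
    | zero => exact ⟨0, by simp⟩
    | add x y hx hy =>
      obtain ⟨φ, hφ, hφ'⟩ := hx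
      obtain ⟨χ, hχ, hχ'⟩ := hy
      exact ⟨φ + χ, by simp only [map_add, hφ, hχ], by simp only [lie_add, map_add, hφ', hχ']⟩
    | single i a =>
      refine ⟨_, (hΘ i a).symm, ?_⟩
      rw [Finsupp.mapRange.addMonoidHom_apply, Finsupp.mapRange_single, hΘ]
      simp only [Submodule.mkQ_apply]
      rw [Submodule.Quotient.eq]
      have hmem := (tangentEnd k K W).smul_mem a (lie_pow_char_mem_tangentEnd hinv p
        (mem_tangentEnd.2 ⟨u, hu, rfl⟩) (mem_tangentEnd.2 ⟨v i, (v i).2, rfl⟩))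
      convert hmem using 1
      ext f
      simp [Ring.lie_def]
      ring
  obtain ⟨φ, hφ, hφ'⟩ := hlift
  rw [LinearMap.mem_ker] at hx ⊢
  rw [← hφ', Submodule.mkQ_apply, Submodule.Quotient.mk_eq_zero]
  rw [hx, Submodule.mkQ_apply, Submodule.Quotient.mk_eq_zero] at hφ
  exact lie_mem_tangentEnd hinv (mem_tangentEnd.2 ⟨u, hu, rfl⟩) hφ

end tangentEnd

section FrobPullback

variable {p : ℕ} [Fact p.Prime] {K : Type*} [Field K] [CharP K p] {M : Type*} [AddCommGroup M]
  [Module K M]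

theorem FrobPullback.smul_one_tmul (a : K) (m : M) :
    (a • ((1 : K) ⊗ₜ[FrobTwist p K] toUnFrob p m : FrobPullback p K M) : FrobPullback p K M) =
      (a ⊗ₜ[FrobTwist p K] toUnFrob p m : FrobPullback p K M) := by
  refine (TensorProduct.smul_tmul' (R := FrobTwist p K) a (1 : K) (toUnFrob p m)).trans ?_
  rw [smul_eq_mul, mul_one]

theorem FrobPullback.one_tmul_smul (a : K) (m : M) :
    ((1 : K) ⊗ₜ[FrobTwist p K] toUnFrob p (a • m) : FrobPullback p K M) =
      (a ^ p : K) • ((1 : K) ⊗ₜ[FrobTwist p K] toUnFrob p m : FrobPullback p K M) := by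
  rw [FrobPullback.smul_one_tmul]
  let a' : FrobTwist p K := a
  have ha : a' • (1 : K) = a ^ p := mul_one _
  rw [← ha]
  exact (TensorProduct.smul_tmul a' (1 : K) (toUnFrob p m)).symm

/-- The additive map `m ↦ 1 ⊗ m` into the Frobenius pull-back. -/
noncomputable def FrobPullback.oneTmul (p : ℕ) [Fact p.Prime] (K : Type*) [Field K] [CharP K p]
    (M : Type*) [AddCommGroup M] [Module K M] : M →+ FrobPullback p K M where
  toFun m := (1 : K) ⊗ₜ[FrobTwist p K] toUnFrob p m
  map_zero' := TensorProduct.tmul_zero _ _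
  map_add' m n := TensorProduct.tmul_add (R := FrobTwist p K) (1 : K) (toUnFrob p m) (toUnFrob p n)

/-- The basis of the Frobenius pull-back induced by a basis. -/
noncomputable def FrobPullback.basis {ι : Type*} (b : Module.Basis ι K M) :
    Module.Basis ι K (FrobPullback p K M) :=
  let b' : Module.Basis ι (FrobTwist p K) (UnFrob p M) := b
  Algebra.TensorProduct.basis K b'

theorem FrobPullback.basis_apply {ι : Type*} (b : Module.Basis ι K M) (i : ι) :
    FrobPullback.basis (p := p) b i = FrobPullback.oneTmul p K M (b i) :=
  let b' : Module.Basis ι (FrobTwist p K) (UnFrob p M) := b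
  Algebra.TensorProduct.basis_apply b' i

end FrobPullback

theorem kernel_of_pCurvature_is_frobenius_pullback_of_a_distribution
    (p : ℕ) [Fact p.Prime]
    (k : Type) [Field k] [IsAlgClosed k] [CharP k p]
    -- `K` is the function field of the smooth algebraic variety `X` over `k`:
    (K : Type) [Field K] [Algebra k K] [CharP K p]
    (hfg : ∃ s : Finset K, IntermediateField.adjoin k (s : Set K) = ⊤)
    (hfd : FiniteDimensional K (Derivation k K K))
    -- the foliation `F`: an involutive `K`-submodule `W = T_F` of the
    -- rational vector fields of `X`
    (W : Submodule K (Derivation k K K))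
    (hinv : ∀ u ∈ W, ∀ v ∈ W, ⁅u, v⁆ ∈ W)
    -- `F` is `p`-dense
    (hpdense : ∀ f : K, (∀ D ∈ W, D f = 0) → KaehlerDifferential.D k K f = 0)
    -- the `p`-curvature `ψ_F : Frob^* T_F → N_F`
    (Ψ : FrobPullback p K (↥W) →ₗ[K] (Module.End k K ⧸ tangentEnd k K W))
    (hΨ : ∀ (f : K) (v : ↥W),
      Ψ (f ⊗ₜ toUnFrob p v) =
        (tangentEnd k K W).mkQ
          (f • ((Derivation.toLinearMap v.val : Module.End k K) ^ p)))
    -- the canonical connection `∇^can` on `Frob^* T_F`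
    (nablaCan : FrobPullback p K (↥W) → Ω[K⁄k] ⊗[K] FrobPullback p K (↥W))
    (hnablaCanAdd : ∀ x y, nablaCan (x + y) = nablaCan x + nablaCan y)
    (hnablaCan : ∀ (f : K) (v : ↥W),
      nablaCan (f ⊗ₜ toUnFrob p v) =
        (KaehlerDifferential.D k K f) ⊗ₜ ((1 : K) ⊗ₜ[FrobTwist p K] toUnFrob p v)) :
    -- (1) the morphism `ker ψ_F → Ω¹_X ⊗ (Frob^* T_F / ker ψ_F)` induced by
    -- `∇^can` is zero, i.e. `∇^can` maps `ker ψ_F` into `Ω¹_X ⊗ ker ψ_F`: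
    (∀ x ∈ LinearMap.ker Ψ,
        nablaCan x ∈ Submodule.span K
          {y : Ω[K⁄k] ⊗[K] FrobPullback p K (↥W) |
            ∃ (a : Ω[K⁄k]) (z : FrobPullback p K (↥W)),
              z ∈ LinearMap.ker Ψ ∧ y = a ⊗ₜ z}) ∧
    -- (2) consequently there is a distribution `F_p ⊆ F`, with tangent
    -- sheaf `U = T_{F_p}`, such that `ker ψ_F = Frob^* T_{F_p}`:
    (∃ U : Submodule K (Derivation k K K), U ≤ W ∧
        LinearMap.ker Ψ = Submodule.span K
          {x : FrobPullback p K (↥W) |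
            ∃ (u : Derivation k K K) (hu : u ∈ W), u ∈ U ∧
              x = (1 : K) ⊗ₜ[FrobTwist p K] toUnFrob p (⟨u, hu⟩ : ↥W)}) := by
  have hsmul (f : K) (v : W) : f • FrobPullback.oneTmul p K W v =
      (f ⊗ₜ[FrobTwist p K] toUnFrob p v : FrobPullback p K W) := FrobPullback.smul_one_tmul f v
  let b := Module.Basis.ofVectorSpace K W
  let B := FrobPullback.basis (p := p) b
  let Θ := Ψ ∘ₗ B.repr.symm.toLinearMap
  have hΘ (i) (a : K) : Θ (Finsupp.single i a) = (tangentEnd k K W).mkQ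
      (a • ((Derivation.toLinearMap (b i).val : Module.End k K) ^ p)) := by
    rw [← hΨ, ← hsmul]
    simp [Θ, B, FrobPullback.basis_apply]
  have hconst := (LinearMap.ker Θ).le_span_setOf_forall_apply_eq_zero
    {δ | ∃ u ∈ W, (u : K →+ K) = δ} (by rintro _ ⟨u, -, rfl⟩; exact u.map_one_eq_zero)
    (by rintro _ ⟨u, hu, rfl⟩ x hx; exact mapRange_mem_ker_pCurvature hinv p hΘ hu hx)
  have hspan : LinearMap.ker Ψ ≤ Submodule.span K
      {x | ∃ u : W, Ψ (FrobPullback.oneTmul p K W u) = 0 ∧ x = FrobPullback.oneTmul p K W u} := by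
    intro x hx
    have hx' : B.repr x ∈ LinearMap.ker Θ := by simpa [Θ] using hx
    have := Submodule.mem_map_of_mem (f := B.repr.symm.toLinearMap) (hconst hx')
    rw [Submodule.map_span] at this
    rw [LinearEquiv.coe_coe, LinearEquiv.symm_apply_apply] at this
    refine Submodule.span_mono ?_ this
    rintro _ ⟨y, ⟨hy, hyW⟩, rfl⟩
    have hroot (i) : ∃ g : K, g ^ p = y i :=
      exists_pow_eq_of_D_eq_zero p (hpdense _ fun D hD => hyW _ ⟨D, hD, rfl⟩ i)
    choose g hg using hroot
    have hyg : B.repr.symm y = FrobPullback.oneTmul p K W (∑ i ∈ y.support, g i • b i) := by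
      rw [map_sum, Module.Basis.repr_symm_apply, Finsupp.linearCombination_apply, Finsupp.sum]
      refine Finset.sum_congr rfl fun i _ => ?_
      rw [← hg i, FrobPullback.basis_apply]
      exact (FrobPullback.one_tmul_smul (g i) (b i)).symm
    exact ⟨_, by rw [← hyg]; exact hy, hyg⟩
  refine ⟨fun x hx => ?_, ?_⟩
  · have hzero : nablaCan 0 = 0 := by simpa using hnablaCanAdd 0 0
    have hx' := hspan hx
    clear hx
    induction hx' using Submodule.closure_induction with
    | zero => rw [hzero]; exact zero_mem _
    | add x y _ _ hx hy => rw [hnablaCanAdd]; exact add_mem hx hy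
    | smul_mem f x hx =>
      obtain ⟨u, hu, rfl⟩ := hx
      rw [hsmul, hnablaCan]
      exact Submodule.subset_span ⟨_, _, hu, rfl⟩
  · let U : Submodule K W :=
      { carrier := {u | Ψ (FrobPullback.oneTmul p K W u) = 0}
        zero_mem' := by simp
        add_mem' := fun {u v} hu hv => by
          rw [Set.mem_ofPred_eq] at hu hv ⊢
          rw [map_add, map_add, hu, hv, add_zero]
        smul_mem' := fun a u hu => by
          rw [Set.mem_ofPred_eq] at hu ⊢
          have : FrobPullback.oneTmul p K W (a • u) = a ^ p • FrobPullback.oneTmul p K W u :=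
            FrobPullback.one_tmul_smul a u
          rw [this, map_smul, hu, smul_zero] }
    refine ⟨U.map W.subtype, Submodule.map_subtype_le W U, le_antisymm ?_ ?_⟩
    · refine hspan.trans (Submodule.span_mono ?_)
      rintro _ ⟨u, hu, rfl⟩
      exact ⟨u, u.2, ⟨u, hu, rfl⟩, rfl⟩
    · refine Submodule.span_le.2 ?_
      rintro _ ⟨_, -, ⟨u, hu, rfl⟩, rfl⟩
      exact hu
end

section
/- Let F be a p-dense foliation on a smooth algebraic variety X over an algebraically closed field of characteristic p > 0. The kernel of the p-curvature of F coincides with the saturation inside T_X of T_F ∩ T_{C(F)}, where C(F) is the Cartier transform of F. -/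
/-- `v` is a rational section of the Cartier transform `C(F)` of the
foliation with tangent sheaf `W`: for every closed rational `1`-form `ω`
vanishing on `T_F`, the contraction `i_v C(ω)` vanishes; by Cartier's
formula this reads `i_{v^p} ω − v^{p−1}(i_v ω) = 0`. -/
def InCartierTransform (p : ℕ) (k K : Type*) [CommRing k] [CommRing K]
    [Algebra k K] (W : Submodule K (Derivation k K K))
    (v : Derivation k K K) : Prop :=
  ∀ ω : Ω[K⁄k], IsClosedRationalOneForm k K ω →
    (∀ u ∈ W, Derivation.liftKaehlerDifferential u ω = 0) →
    ∀ vp : Derivation k K K,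
      Derivation.toLinearMap vp = (Derivation.toLinearMap v : Module.End k K) ^ p →
      Derivation.liftKaehlerDifferential vp ω -
        (((Derivation.toLinearMap v : Module.End k K) ^ (p - 1))
          (Derivation.liftKaehlerDifferential v ω)) = 0

/-- In characteristic `p`, the commutator with `x ^ p` is the `p`-th iterate of the commutator
with `x`. -/
theorem commutator_pow_char (k : Type*) {A : Type*} [Field k] [Ring A] [Nontrivial A] [Algebra k A]
    (p : ℕ) [Fact p.Prime] [CharP k p] (x y : A) :
    x ^ p * y - y * x ^ p = (fun z => x * z - z * x)^[p] y := by
  have : CharP (Module.End k A) p :=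
    charP_of_injective_algebraMap (algebraMap k (Module.End k A)).injective p
  have hc : Commute (LinearMap.mulLeft k x) (LinearMap.mulRight k x) :=
    LinearMap.commute_mulLeft_right x x
  have h := congrArg (fun φ : Module.End k A => φ y) (sub_pow_char_of_commute (p := p) hc)
  simp only [LinearMap.pow_mulLeft, LinearMap.pow_mulRight, LinearMap.sub_apply,
    LinearMap.mulLeft_apply, LinearMap.mulRight_apply] at h
  rw [← h, Module.End.pow_apply]
  rfl

section Operators

variable {k K : Type*} [Field k] [Field K] [Algebra k K]

namespace Derivation

theorem mul_lmul (v : Derivation k K K) (g : K) :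
    (v.toLinearMap : Module.End k K) * Algebra.lmul k K g =
      Algebra.lmul k K g * v.toLinearMap + Algebra.lmul k K (v g) := by
  ext x
  simp [mul_comm]

theorem smul_lie_eq (g : K) (u v : Derivation k K K) : ⁅g • u, v⁆ = g • ⁅u, v⁆ - v g • u := by
  ext x
  simp only [commutator_apply, smul_apply, sub_apply, leibniz, smul_eq_mul]
  ring

theorem lie_smul_eq (g : K) (u v : Derivation k K K) : ⁅u, g • v⁆ = g • ⁅u, v⁆ + u g • v := by
  ext x
  simp only [commutator_apply, smul_apply, add_apply, leibniz, smul_eq_mul]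
  ring

/-- The `p`-th iterate of a derivation in characteristic `p`. -/
def powChar (p : ℕ) [Fact p.Prime] [CharP k p] (v : Derivation k K K) : Derivation k K K :=
  Derivation.mk' ((v.toLinearMap : Module.End k K) ^ p) fun a b => by
    have h := commutator_pow_char k p (v.toLinearMap : Module.End k K) (Algebra.lmul k K a)
    have h1 : ∀ n : ℕ, (fun z : Module.End k K => v.toLinearMap * z - z * v.toLinearMap)^[n]
        (Algebra.lmul k K a) = Algebra.lmul k K (((v.toLinearMap : Module.End k K) ^ n) a) := by
      intro n
      induction n with
      | zero => simp
      | succ n ih =>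
        rw [Function.iterate_succ_apply', ih, mul_lmul, add_sub_cancel_left, pow_succ']
        rfl
    rw [h1] at h
    have h2 := congrArg (fun φ : Module.End k K => φ b) h
    simp only [LinearMap.sub_apply, Module.End.mul_apply, Algebra.coe_lmul_eq_mul,
      LinearMap.mul_apply'] at h2
    rw [sub_eq_iff_eq_add] at h2
    rw [h2, smul_eq_mul, smul_eq_mul]
    ring

theorem toLinearMap_powChar (p : ℕ) [Fact p.Prime] [CharP k p] (v : Derivation k K K) :
    (v.powChar p).toLinearMap = (v.toLinearMap : Module.End k K) ^ p := rfl

theorem toLinearMap_injective :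
    Function.Injective (fun v : Derivation k K K => (v.toLinearMap : Module.End k K)) :=
  fun _ _ h => Derivation.ext fun x => congrArg (fun φ : Module.End k K => φ x) h

theorem toLinearMap_lie (u v : Derivation k K K) :
    (⁅u, v⁆ : Derivation k K K).toLinearMap =
      (u.toLinearMap : Module.End k K) * v.toLinearMap - v.toLinearMap * u.toLinearMap := rfl

theorem powChar_lie (p : ℕ) [Fact p.Prime] [CharP k p] (u v : Derivation k K K) :
    ⁅u.powChar p, v⁆ = (fun w => ⁅u, w⁆)^[p] v := by
  apply toLinearMap_injective
  have h : ∀ n : ℕ, ((fun w : Derivation k K K => ⁅u, w⁆)^[n] v).toLinearMap =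
      (fun z : Module.End k K => u.toLinearMap * z - z * u.toLinearMap)^[n] v.toLinearMap := by
    intro n
    induction n with
    | zero => rfl
    | succ n ih => rw [Function.iterate_succ_apply', Function.iterate_succ_apply', ← ih]; rfl
  simp only [h, toLinearMap_lie, toLinearMap_powChar]
  exact commutator_pow_char k p _ _

theorem sum_apply_eq {ι : Type*} (s : Finset ι) (D : ι → Derivation k K K) (x : K) :
    (∑ j ∈ s, D j) x = ∑ j ∈ s, D j x :=
  map_sum ((Pi.evalAddMonoidHom _ x).comp Derivation.coeFnAddMonoidHom) D s

end Derivation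

/-- The operators of multiplication by an element of `K`. -/
def multiplicationOperators (k K : Type*) [Field k] [Field K] [Algebra k K] :
    Submodule k (Module.End k K) :=
  LinearMap.range (Algebra.lmul k K).toLinearMap

theorem one_mem_multiplicationOperators (k K : Type*) [Field k] [Field K] [Algebra k K] :
    1 ∈ multiplicationOperators k K :=
  ⟨1, map_one (Algebra.lmul k K)⟩

/-- The differential operators of the form `g + v` with `g ∈ K` and `v ∈ V`. -/
def firstOrderOperators (V : Submodule K (Derivation k K K)) : Submodule k (Module.End k K) where
  carrier := {a | ∃ g : K, ∃ v ∈ V, a = Algebra.lmul k K g + v.toLinearMap}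
  zero_mem' := ⟨0, 0, V.zero_mem, by ext; simp⟩
  add_mem' := by
    rintro _ _ ⟨g, v, hv, rfl⟩ ⟨h, w, hw, rfl⟩
    exact ⟨g + h, v + w, V.add_mem hv hw, by ext; simp; ring⟩
  smul_mem' := by
    rintro c _ ⟨g, v, hv, rfl⟩
    refine ⟨c • g, algebraMap k K c • v, V.smul_mem _ hv, ?_⟩
    ext; simp [Algebra.smul_def]; ring

/-- The filtration by order on the algebra of differential operators generated by `K` and `V`. -/
def orderFiltration (V : Submodule K (Derivation k K K)) : ℕ → Submodule k (Module.End k K)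
  | 0 => multiplicationOperators k K
  | n + 1 => firstOrderOperators V * orderFiltration V n

variable {V : Submodule K (Derivation k K K)}

theorem lmul_mem_firstOrderOperators (g : K) : Algebra.lmul k K g ∈ firstOrderOperators V :=
  ⟨g, 0, V.zero_mem, by ext; simp⟩

theorem toLinearMap_mem_firstOrderOperators {v : Derivation k K K} (hv : v ∈ V) :
    (v.toLinearMap : Module.End k K) ∈ firstOrderOperators V :=
  ⟨0, v, hv, by ext; simp⟩

theorem lmul_mul_mem_firstOrderOperators (g : K) {a : Module.End k K}
    (ha : a ∈ firstOrderOperators V) : Algebra.lmul k K g * a ∈ firstOrderOperators V := by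
  obtain ⟨h, v, hv, rfl⟩ := ha
  exact ⟨g * h, g • v, V.smul_mem _ hv, by ext; simp; ring⟩

theorem mul_lmul_mem_firstOrderOperators (g : K) {a : Module.End k K}
    (ha : a ∈ firstOrderOperators V) : a * Algebra.lmul k K g ∈ firstOrderOperators V := by
  obtain ⟨h, v, hv, rfl⟩ := ha
  exact ⟨h * g + v g, g • v, V.smul_mem _ hv, by ext; simp; ring⟩

theorem commutator_mem_firstOrderOperators (hV : ∀ u ∈ V, ∀ v ∈ V, ⁅u, v⁆ ∈ V)
    {a b : Module.End k K} (ha : a ∈ firstOrderOperators V) (hb : b ∈ firstOrderOperators V) :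
    a * b - b * a ∈ firstOrderOperators V := by
  obtain ⟨g, u, hu, rfl⟩ := ha
  obtain ⟨h, v, hv, rfl⟩ := hb
  exact ⟨u h - v g, ⁅u, v⁆, hV u hu v hv, by
    rw [Derivation.toLinearMap_lie]; ext; simp; ring⟩

theorem commutator_lmul_mem (g : K) {a : Module.End k K} (ha : a ∈ firstOrderOperators V) :
    a * Algebra.lmul k K g - Algebra.lmul k K g * a ∈ multiplicationOperators k K := by
  obtain ⟨h, v, -, rfl⟩ := ha
  exact ⟨v g, by ext; simp; ring⟩

theorem mul_mem_orderFiltration {a b : Module.End k K} {n : ℕ} (ha : a ∈ firstOrderOperators V)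
    (hb : b ∈ orderFiltration V n) : a * b ∈ orderFiltration V (n + 1) :=
  Submodule.mul_mem_mul ha hb

theorem orderFiltration_one : orderFiltration V 1 = firstOrderOperators V := by
  apply le_antisymm
  · refine Submodule.mul_le.2 ?_
    rintro a ha _ ⟨g, rfl⟩
    exact mul_lmul_mem_firstOrderOperators g ha
  · intro a ha
    simpa only [mul_one] using
      mul_mem_orderFiltration (n := 0) ha (one_mem_multiplicationOperators k K)

theorem orderFiltration_mono : Monotone (orderFiltration V) := by
  refine monotone_nat_of_le_succ fun n a ha => ?_
  simpa only [map_one, one_mul] using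
    mul_mem_orderFiltration (lmul_mem_firstOrderOperators (V := V) 1) ha

theorem lmul_mul_mem_orderFiltration (g : K) {a : Module.End k K} {n : ℕ}
    (ha : a ∈ orderFiltration V n) : Algebra.lmul k K g * a ∈ orderFiltration V n := by
  cases n with
  | zero =>
    obtain ⟨h, rfl⟩ := ha
    exact ⟨g * h, map_mul (Algebra.lmul k K) g h⟩
  | succ n =>
    refine Submodule.mul_induction_on ha (fun b hb c hc => ?_) fun b c hb hc => ?_
    · rw [← mul_assoc]
      exact mul_mem_orderFiltration (lmul_mul_mem_firstOrderOperators g hb) hc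
    · rw [mul_add]
      exact add_mem hb hc

theorem commutator_mem_orderFiltration (hV : ∀ u ∈ V, ∀ v ∈ V, ⁅u, v⁆ ∈ V)
    {a b : Module.End k K} {n : ℕ} (ha : a ∈ firstOrderOperators V)
    (hb : b ∈ orderFiltration V n) : a * b - b * a ∈ orderFiltration V n := by
  induction n generalizing b with
  | zero =>
    obtain ⟨h, rfl⟩ := hb
    exact commutator_lmul_mem h ha
  | succ n ih =>
    refine Submodule.mul_induction_on hb (fun b hb c hc => ?_) fun b c hb hc => ?_
    · have h : a * (b * c) - b * c * a = (a * b - b * a) * c + b * (a * c - c * a) := by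
        simp only [mul_sub, sub_mul, mul_assoc]
        abel
      rw [h]
      exact add_mem (mul_mem_orderFiltration (commutator_mem_firstOrderOperators hV ha hb) hc)
        (mul_mem_orderFiltration hb (ih hc))
    · have h : a * (b + c) - (b + c) * a = (a * b - b * a) + (a * c - c * a) := by noncomm_ring
      rw [h]
      exact add_mem hb hc

/-- Modulo operators of order `< p`, the `p`-th power is additive on first order operators. -/
theorem add_pow_char_sub_mem_orderFiltration (p : ℕ) [hp : Fact p.Prime] [CharP k p]
    (hV : ∀ u ∈ V, ∀ v ∈ V, ⁅u, v⁆ ∈ V) {a b : Module.End k K}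
    (ha : a ∈ firstOrderOperators V) (hb : b ∈ firstOrderOperators V) :
    (a + b) ^ p - (a ^ p + b ^ p) ∈ orderFiltration V (p - 1) := by
  have : CharP (Module.End k (Module.End k K)) p :=
    charP_of_injective_algebraMap (algebraMap k _).injective p
  let Φ : Module.End k (Module.End k K) := LinearMap.mulLeft k a + LinearMap.mulRight k b
  have hΦ : ∀ c, Φ c = (a + b) * c - (b * c - c * b) := fun c => by
    simp only [Φ, LinearMap.add_apply, LinearMap.mulLeft_apply, LinearMap.mulRight_apply]
    noncomm_ring
  have hmem : ∀ n, (Φ ^ n) 1 ∈ orderFiltration V n := by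
    intro n
    induction n with
    | zero => exact one_mem_multiplicationOperators k K
    | succ n ih =>
      rw [pow_succ', Module.End.mul_apply, hΦ]
      exact sub_mem (mul_mem_orderFiltration (add_mem ha hb) ih)
        (orderFiltration_mono n.le_succ (commutator_mem_orderFiltration hV hb ih))
  have hsub : ∀ n, (a + b) ^ (n + 1) - (Φ ^ (n + 1)) 1 ∈ orderFiltration V n := by
    intro n
    induction n with
    | zero => simp [hΦ]
    | succ n ih =>
      rw [pow_succ' (a + b), pow_succ' Φ, Module.End.mul_apply, hΦ, sub_sub_eq_add_sub,
        add_sub_right_comm, ← mul_sub]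
      exact add_mem (mul_mem_orderFiltration (add_mem ha hb) ih)
        (commutator_mem_orderFiltration hV hb (hmem _))
  have h := hsub (p - 1)
  rw [Nat.sub_add_cancel hp.out.one_le] at h
  have hc : Commute (LinearMap.mulLeft k a) (LinearMap.mulRight k b) :=
    LinearMap.commute_mulLeft_right a b
  rw [add_pow_char_of_commute (p := p) hc] at h
  simpa using h

theorem lmul_mul_pow_sub_mem_orderFiltration (g : K) {v : Derivation k K K} (hv : v ∈ V) (n : ℕ) :
    (Algebra.lmul k K g * v.toLinearMap) ^ (n + 1) -
      Algebra.lmul k K (g ^ (n + 1)) * (v.toLinearMap : Module.End k K) ^ (n + 1) ∈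
        orderFiltration V n := by
  have hv1 := toLinearMap_mem_firstOrderOperators hv
  have hpow : ∀ n, (v.toLinearMap : Module.End k K) ^ n ∈ orderFiltration V n := by
    intro n
    induction n with
    | zero => exact one_mem_multiplicationOperators k K
    | succ n ih =>
      rw [pow_succ']
      exact mul_mem_orderFiltration hv1 ih
  induction n with
  | zero => simp
  | succ n ih =>
    have h : (Algebra.lmul k K g * v.toLinearMap) ^ (n + 1 + 1) -
        Algebra.lmul k K (g ^ (n + 1 + 1)) * (v.toLinearMap : Module.End k K) ^ (n + 1 + 1) =
      (Algebra.lmul k K g * v.toLinearMap) * ((Algebra.lmul k K g * v.toLinearMap) ^ (n + 1) -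
        Algebra.lmul k K (g ^ (n + 1)) * (v.toLinearMap : Module.End k K) ^ (n + 1)) +
      Algebra.lmul k K (g * v (g ^ (n + 1))) * (v.toLinearMap : Module.End k K) ^ (n + 1) := by
      have hvg := v.mul_lmul (g ^ (n + 1))
      rw [pow_succ' _ (n + 1), pow_succ' g (n + 1), pow_succ' (v.toLinearMap : Module.End k K),
        mul_sub, map_mul, map_mul]
      rw [show ∀ x : Module.End k K, Algebra.lmul k K g * v.toLinearMap *
        (Algebra.lmul k K (g ^ (n + 1)) * x) = Algebra.lmul k K g *
          ((v.toLinearMap : Module.End k K) * Algebra.lmul k K (g ^ (n + 1))) * x from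
          fun x => by simp only [mul_assoc], hvg]
      simp only [mul_add, add_mul, mul_assoc]
      abel
    rw [h]
    exact add_mem (mul_mem_orderFiltration (lmul_mul_mem_firstOrderOperators g hv1) ih)
      (lmul_mul_mem_orderFiltration _ (hpow _))


theorem pow_char_mem_orderFiltration_of_mem_span (p : ℕ) [hp : Fact p.Prime] [CharP k p]
    {S : Set (Derivation k K K)}
    (hV : ∀ u ∈ Submodule.span K S, ∀ v ∈ Submodule.span K S, ⁅u, v⁆ ∈ Submodule.span K S)
    (hS : ∀ s ∈ S, s.powChar p ∈ Submodule.span K S) {v : Derivation k K K}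
    (hv : v ∈ Submodule.span K S) :
    (v.toLinearMap : Module.End k K) ^ p ∈ orderFiltration (Submodule.span K S) (p - 1) := by
  have hp1 : p - 1 + 1 = p := Nat.sub_add_cancel hp.out.one_le
  induction hv using Submodule.span_induction with
  | mem s hs =>
    have h1 : 1 ≤ p - 1 := Nat.le_sub_one_of_lt hp.out.one_lt
    refine orderFiltration_mono h1 ?_
    rw [orderFiltration_one]
    exact toLinearMap_mem_firstOrderOperators (hS s hs)
  | zero =>
    rw [show ((0 : Derivation k K K).toLinearMap : Module.End k K) = 0 from rfl,
      zero_pow hp.out.ne_zero]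
    exact zero_mem _
  | add a b ha hb iha ihb =>
    have h := add_pow_char_sub_mem_orderFiltration p hV (toLinearMap_mem_firstOrderOperators ha)
      (toLinearMap_mem_firstOrderOperators hb)
    simpa using add_mem h (add_mem iha ihb)
  | smul g a ha iha =>
    have h := lmul_mul_pow_sub_mem_orderFiltration g ha (p - 1)
    rw [hp1] at h
    have h2 := add_mem h (lmul_mul_mem_orderFiltration (g ^ p) iha)
    rw [sub_add_cancel] at h2
    exact h2

section DualSystem

variable {ι : Type*} [Fintype ι] {y : ι → K} {D : ι → Derivation k K K}

/-- For elements `y j` of `K` and derivations `D j` spanning `V` and dual to each other, the Euler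
operator `Q ↦ ∑ j, [Q, y j] * D j` acts on operators of order `n + 1` as multiplication by `n + 1`,
modulo operators of order `n`. -/
theorem euler_sub_mem_orderFiltration (hV : ∀ u ∈ V, ∀ v ∈ V, ⁅u, v⁆ ∈ V) (hD : ∀ i, D i ∈ V)
    (hy : ∀ v ∈ V, v = ∑ j, v (y j) • D j) (n : ℕ) {Q : Module.End k K}
    (hQ : Q ∈ orderFiltration V (n + 1)) :
    ∑ j, (Q * Algebra.lmul k K (y j) - Algebra.lmul k K (y j) * Q) * (D j).toLinearMap
      - (n + 1) • Q ∈ orderFiltration V n := by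
  have hcomm : ∀ (g : K) (v : Derivation k K K) (j : ι),
      (Algebra.lmul k K g + v.toLinearMap) * Algebra.lmul k K (y j) -
        Algebra.lmul k K (y j) * (Algebra.lmul k K g + v.toLinearMap) =
      Algebra.lmul k K (v (y j)) := fun g v j => by ext; simp; ring
  have hsum : ∀ v ∈ V, (v.toLinearMap : Module.End k K) =
      ∑ j, Algebra.lmul k K (v (y j)) * (D j).toLinearMap := fun v hv => by
    ext x
    have h := congrArg (fun w : Derivation k K K => w x) (hy v hv)
    simpa [Derivation.sum_apply_eq] using h
  induction n generalizing Q with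
  | zero =>
    rw [orderFiltration_one] at hQ
    obtain ⟨g, v, hv, rfl⟩ := hQ
    simp only [hcomm, ← hsum v hv]
    exact ⟨-g, by ext; simp⟩
  | succ n ih =>
    refine Submodule.mul_induction_on hQ (fun b hb c hc => ?_) fun b c hb hc => ?_
    · have hb' := hb
      obtain ⟨g, v, hv, rfl⟩ := hb'
      set b := Algebra.lmul k K g + (v.toLinearMap : Module.End k K) with hbdef
      have hterm : ∀ j, (b * c * Algebra.lmul k K (y j) - Algebra.lmul k K (y j) * (b * c)) *
            (D j).toLinearMap =
          b * ((c * Algebra.lmul k K (y j) - Algebra.lmul k K (y j) * c) * (D j).toLinearMap) +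
          Algebra.lmul k K (v (y j)) * (D j).toLinearMap * c -
          Algebra.lmul k K (v (y j)) *
            ((D j).toLinearMap * c - c * (D j).toLinearMap) := fun j => by
        rw [← hcomm g v j, ← hbdef]
        simp only [mul_sub, sub_mul, mul_assoc]
        abel
      have key : ∑ j, (b * c * Algebra.lmul k K (y j) - Algebra.lmul k K (y j) * (b * c)) *
            (D j).toLinearMap - (n + 1 + 1) • (b * c) =
          b * (∑ j, (c * Algebra.lmul k K (y j) - Algebra.lmul k K (y j) * c) *
            (D j).toLinearMap - (n + 1) • c) - Algebra.lmul k K g * c -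
          ∑ j, Algebra.lmul k K (v (y j)) *
            ((D j).toLinearMap * c - c * (D j).toLinearMap) := by
        simp only [hterm, Finset.sum_sub_distrib, Finset.sum_add_distrib, ← Finset.mul_sum,
          ← Finset.sum_mul, ← hsum v hv]
        rw [mul_sub, mul_smul_comm, succ_nsmul (b * c) (n + 1),
          show (v.toLinearMap : Module.End k K) = b - Algebra.lmul k K g by simp [hbdef], sub_mul]
        abel
      rw [key]
      refine sub_mem (sub_mem (mul_mem_orderFiltration hb (ih hc))
        (lmul_mul_mem_orderFiltration g hc)) (sum_mem fun j _ => ?_)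
      exact lmul_mul_mem_orderFiltration _
        (commutator_mem_orderFiltration hV (toLinearMap_mem_firstOrderOperators (hD j)) hc)
    · convert add_mem hb hc using 1
      rw [sub_add_sub_comm, ← Finset.sum_add_distrib, ← smul_add]
      congr 1
      refine Finset.sum_congr rfl fun j _ => ?_
      simp only [mul_add, sub_mul, add_mul]
      abel

theorem mem_multiplicationOperators_of_commute (p : ℕ) [CharP k p]
    (hV : ∀ u ∈ V, ∀ v ∈ V, ⁅u, v⁆ ∈ V) (hD : ∀ i, D i ∈ V)
    (hy : ∀ v ∈ V, v = ∑ j, v (y j) • D j) {n : ℕ} (hn : n < p) {Q : Module.End k K}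
    (hQ : Q ∈ orderFiltration V n) (hc : ∀ j, Commute Q (Algebra.lmul k K (y j))) :
    Q ∈ multiplicationOperators k K := by
  induction n with
  | zero => exact hQ
  | succ n ih =>
    have h := euler_sub_mem_orderFiltration hV hD hy n hQ
    simp only [(hc _).eq, sub_self, zero_mul, Finset.sum_const_zero, zero_sub] at h
    refine ih (by omega) ?_
    have hne : ((n + 1 : ℕ) : k) ≠ 0 := by
      rw [Ne, CharP.cast_eq_zero_iff k p]
      exact Nat.not_dvd_of_pos_of_lt n.succ_pos hn
    rw [neg_mem_iff, ← Nat.cast_smul_eq_nsmul k] at h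
    exact (Submodule.smul_mem_iff _ hne).1 h

theorem powChar_eq_zero_of_apply_eq_zero (p : ℕ) [hp : Fact p.Prime] [CharP k p]
    (hV : ∀ u ∈ V, ∀ v ∈ V, ⁅u, v⁆ ∈ V) (hD : ∀ i, D i ∈ V)
    (hy : ∀ v ∈ V, v = ∑ j, v (y j) • D j) {v : Derivation k K K}
    (hv : (v.toLinearMap : Module.End k K) ^ p ∈ orderFiltration V (p - 1))
    (hvy : ∀ j, v.powChar p (y j) = 0) : v.powChar p = 0 := by
  obtain ⟨g, hg⟩ := mem_multiplicationOperators_of_commute p hV hD hy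
    (Nat.sub_lt hp.out.pos one_pos) hv fun j => by
      have h := (v.powChar p).mul_lmul (y j)
      rwa [hvy, map_zero, add_zero] at h
  have hg' : ∀ x, v.powChar p x = g * x := fun x =>
    (congrArg (fun φ : Module.End k K => φ x) hg).symm
  have h0 : g = 0 := by simpa using (hg' 1).symm
  ext x
  simp [hg', h0]

/-- A derivation vanishing on the constants of commuting derivations `D i` with `D i ^ p = 0`, and
on elements `y i` dual to the `D i`, is zero. -/
theorem derivation_eq_zero_of_dual_system (p : ℕ) [hp : Fact p.Prime] [CharP k p] [DecidableEq ι]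
    (hdual : ∀ i j, D i (y j) = if i = j then 1 else 0) (hcomm : ∀ i j, ⁅D i, D j⁆ = 0)
    (hpow : ∀ i, (D i).powChar p = 0) {E : Derivation k K K}
    (hE : ∀ f, (∀ i, D i f = 0) → E f = 0) (hEy : ∀ i, E (y i) = 0) : E = 0 := by
  have hswap : ∀ i j x, D i (D j x) = D j (D i x) := fun i j x => by
    have h := congrArg (fun w : Derivation k K K => w x) (hcomm i j)
    simpa [Derivation.commutator_apply, sub_eq_zero] using h
  have main : ∀ t : Finset ι, ∀ f, (∀ i ∉ t, D i f = 0) → E f = 0 := by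
    intro t
    induction t using Finset.induction_on with
    | empty => exact fun f hf => hE f fun i => hf i (Finset.notMem_empty i)
    | insert a t ha ih =>
      have hstep : ∀ m ≤ p, ∀ f, (∀ i ∉ insert a t, D i f = 0) →
          ((D a).toLinearMap : Module.End k K) ^ m • f = 0 → E f = 0 := by
        intro m
        induction m with
        | zero =>
          intro _ f _ hf
          rw [show f = 0 by simpa using hf, map_zero]
        | succ m ihm =>
          intro hm f hf hfm
          have hcom : ∀ n i, i ∉ insert a t →
              D i ((((D a).toLinearMap : Module.End k K) ^ n) f) = 0 := by
            intro n
            induction n with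
            | zero => exact fun i hi => hf i hi
            | succ n ihn =>
              intro i hi
              rw [pow_succ', Module.End.mul_apply]
              exact (hswap i a _).trans (by rw [ihn i hi, map_zero])
          set c := (((D a).toLinearMap : Module.End k K) ^ m) f with hc
          have hDc : D a c = 0 := by
            rw [pow_succ'] at hfm
            exact hfm
          have hfact : (m.factorial : K) ≠ 0 := by
            have : CharP K p := charP_of_injective_algebraMap (algebraMap k K).injective p
            rw [Ne, CharP.cast_eq_zero_iff K p, hp.out.dvd_factorial]
            omega
          have hEc : E c = 0 := by
            refine ih c fun i hi => ?_
            rcases eq_or_ne i a with rfl | hia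
            · exact hDc
            · exact hcom m i (by simp [hia, hi])
          have hpowy : ∀ n e, D a e = 0 →
              (((D a).toLinearMap : Module.End k K) ^ n) (e * y a ^ n) = n.factorial * e := by
            intro n
            induction n with
            | zero => intro e _; simp
            | succ n ihn =>
              intro e he
              have h1 : D a (e * y a ^ (n + 1)) = ((n + 1 : ℕ) * e) * y a ^ n := by
                rw [Derivation.leibniz, Derivation.leibniz_pow, he, hdual]
                simp
                ring
              rw [pow_succ, Module.End.mul_apply]
              erw [h1]
              rw [ihn _ (by simp [Derivation.leibniz, he]), Nat.factorial_succ]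
              push_cast
              ring
          have hzero : E (f - c * (m.factorial : K)⁻¹ * y a ^ m) = 0 := by
            have hinv : ∀ i, D i c = 0 → D i (c * (m.factorial : K)⁻¹) = 0 := fun i hi => by
              simp [Derivation.leibniz, Derivation.leibniz_inv, hi]
            refine ihm (by omega) _ (fun i hi => ?_) ?_
            · have hia : i ≠ a := fun h => hi (h ▸ Finset.mem_insert_self a t)
              rw [map_sub, hf i hi, Derivation.leibniz, Derivation.leibniz_pow, hdual, if_neg hia,
                hinv i (hcom m i hi)]
              simp
            · rw [smul_sub]
              have h2 := hpowy m _ (hinv a hDc)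
              rw [Module.End.smul_def, Module.End.smul_def, h2, ← hc]
              field_simp
              simp
          rw [map_sub, sub_eq_zero] at hzero
          rw [hzero]
          simp [Derivation.leibniz, Derivation.leibniz_pow, Derivation.leibniz_inv, hEc, hEy]
      exact fun f hf => hstep p le_rfl f hf
        (congrArg (fun w : Derivation k K K => w f) (hpow a))
  ext f
  exact main Finset.univ f fun i hi => absurd (Finset.mem_univ i) hi

end DualSystem

theorem exists_dual_system (V : Submodule K (Derivation k K K)) [FiniteDimensional K V] :
    ∃ (n : ℕ) (y : Fin n → K) (D : Fin n → Derivation k K K), (∀ i, D i ∈ V) ∧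
      (∀ i j, D i (y j) = if i = j then 1 else 0) ∧ ∀ v ∈ V, v = ∑ j, v (y j) • D j := by
  let ev : K → Module.Dual K V := fun x =>
    { toFun := fun v => v.1 x
      map_add' := fun _ _ => rfl
      map_smul' := fun _ _ => rfl }
  have hspan : ⊤ ≤ Submodule.span K (Set.range ev) := by
    rw [← Subspace.dualCoannihilator_dualAnnihilator_eq (W := Submodule.span K (Set.range ev)),
      show (Submodule.span K (Set.range ev)).dualCoannihilator = ⊥ from ?_,
      Submodule.dualAnnihilator_bot]
    rw [eq_bot_iff]
    intro v hv
    rw [Submodule.mem_dualCoannihilator] at hv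
    exact Subtype.ext (Derivation.ext fun x => hv (ev x) (Submodule.subset_span ⟨x, rfl⟩))
  let b₀ := Module.Basis.ofSpan hspan
  have hfin := Module.Finite.finite_basis b₀
  let b := b₀.reindex (Finite.equivFin _)
  have hb : ∀ i, ∃ x, ev x = b i := fun i => by
    refine Module.Basis.ofSpan_subset hspan ?_
    rw [← Module.Basis.range_reindex b₀ (Finite.equivFin _)]
    exact ⟨i, rfl⟩
  choose y hy using hb
  let D : Fin _ → V := fun i => (Module.evalEquiv K V).symm (b.dualBasis i)
  have hdual : ∀ i j, b j (D i) = if i = j then 1 else 0 := fun i j => by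
    rw [Module.apply_evalEquiv_symm_apply, Module.Basis.dualBasis_apply_self]
    simp only [eq_comm]
  have hby : ∀ (v : V) j, v.1 (y j) = b j v := fun v j => by rw [← hy]; rfl
  refine ⟨_, y, fun i => (D i).1, fun i => (D i).2, fun i j => ?_, fun v hv => ?_⟩
  · rw [hby, hdual]
  · have h : (⟨v, hv⟩ : V) = ∑ j, v (y j) • D j := by
      apply (Module.evalEquiv K V).injective
      refine b.ext fun i => ?_
      simp only [Module.evalEquiv_apply, Module.Dual.eval_apply, map_sum, map_smul,
        LinearMap.sum_apply, LinearMap.smul_apply, hdual, smul_eq_mul, mul_ite, mul_one, mul_zero,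
        Finset.sum_ite_eq', Finset.mem_univ, if_true]
      exact (hby ⟨v, hv⟩ i).symm
    simpa using congrArg Subtype.val h

/-- A finite-dimensional space of derivations which is closed under brackets and spanned by
derivations whose `p`-th powers it contains is all of `Der_k(K)` as soon as every derivation
vanishes on its constants. -/
theorem span_eq_top_of_constants (p : ℕ) [hp : Fact p.Prime] [CharP k p]
    [FiniteDimensional K (Derivation k K K)] {S : Set (Derivation k K K)}
    (hV : ∀ u ∈ Submodule.span K S, ∀ v ∈ Submodule.span K S, ⁅u, v⁆ ∈ Submodule.span K S)
    (hS : ∀ s ∈ S, s.powChar p ∈ Submodule.span K S)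
    (hconst : ∀ f : K, (∀ s ∈ S, s f = 0) → ∀ E : Derivation k K K, E f = 0) :
    Submodule.span K S = ⊤ := by
  obtain ⟨n, y, D, hD, hdual, hy⟩ := exists_dual_system (Submodule.span K S)
  have hcomm : ∀ i j, ⁅D i, D j⁆ = 0 := fun i j => by
    rw [hy _ (hV _ (hD i) _ (hD j))]
    refine Finset.sum_eq_zero fun l _ => ?_
    rw [Derivation.commutator_apply, hdual, hdual]
    split_ifs <;> simp
  have hpow : ∀ i, (D i).powChar p = 0 := fun i => by
    refine powChar_eq_zero_of_apply_eq_zero p hV hD hy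
      (pow_char_mem_orderFiltration_of_mem_span p hV hS (hD i)) fun j => ?_
    obtain ⟨m, hm⟩ := Nat.exists_eq_add_of_le' hp.out.two_le
    change (((D i).toLinearMap : Module.End k K) ^ p) (y j) = 0
    rw [hm, pow_add, pow_two, Module.End.mul_apply, Module.End.mul_apply]
    have h : D i (D i (y j)) = 0 := by
      rw [hdual]
      split_ifs <;> simp
    exact (congrArg _ h).trans (map_zero _)
  rw [eq_top_iff]
  intro E _
  have hmem : ∑ j, E (y j) • D j ∈ Submodule.span K S :=
    sum_mem fun j _ => Submodule.smul_mem _ _ (hD j)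
  suffices h : E - ∑ j, E (y j) • D j = 0 by
    rwa [sub_eq_zero.1 h]
  refine derivation_eq_zero_of_dual_system p hdual hcomm hpow (fun f hf => ?_) fun i => ?_
  · refine hconst f (fun s hs => ?_) _
    rw [hy s (Submodule.subset_span hs), Derivation.sum_apply_eq]
    exact Finset.sum_eq_zero fun j _ => by simp [hf j]
  · simp [Derivation.sum_apply_eq, hdual]

/-- The iterated `p`-th powers of the derivations in `W`. -/
inductive IsIteratedPowChar (p : ℕ) [Fact p.Prime] [CharP k p]
    (W : Submodule K (Derivation k K K)) : Derivation k K K → Prop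
  | of_mem {w : Derivation k K K} : w ∈ W → IsIteratedPowChar p W w
  | powChar {s : Derivation k K K} : IsIteratedPowChar p W s → IsIteratedPowChar p W (s.powChar p)

namespace IsIteratedPowChar

variable {p : ℕ} [hp : Fact p.Prime] [CharP k p] {W : Submodule K (Derivation k K K)}

theorem lie_mem_of_mem (hW : ∀ u ∈ W, ∀ v ∈ W, ⁅u, v⁆ ∈ W) {s : Derivation k K K}
    (hs : IsIteratedPowChar p W s) {w : Derivation k K K} (hw : w ∈ W) : ⁅s, w⁆ ∈ W := by
  induction hs generalizing w with
  | of_mem hu => exact hW _ hu _ hw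
  | powChar _ ih =>
    rw [Derivation.powChar_lie]
    exact Function.Iterate.rec (· ∈ W) hw (fun _ h => ih h) p

theorem lie_mem (hW : ∀ u ∈ W, ∀ v ∈ W, ⁅u, v⁆ ∈ W) {s t : Derivation k K K}
    (hs : IsIteratedPowChar p W s) (ht : IsIteratedPowChar p W t) : ⁅s, t⁆ ∈ W := by
  induction hs with
  | of_mem hu =>
    rw [← lie_skew]
    exact neg_mem (ht.lie_mem_of_mem hW hu)
  | powChar hs ih =>
    rw [Derivation.powChar_lie, ← Nat.sub_add_cancel hp.out.one_le, Function.iterate_succ_apply]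
    exact Function.Iterate.rec (· ∈ W) ih (fun _ h => hs.lie_mem_of_mem hW h) (p - 1)

theorem span_eq_top [FiniteDimensional K (Derivation k K K)]
    (hW : ∀ u ∈ W, ∀ v ∈ W, ⁅u, v⁆ ∈ W)
    (hconst : ∀ f : K, (∀ w ∈ W, w f = 0) → KaehlerDifferential.D k K f = 0) :
    Submodule.span K {s | IsIteratedPowChar p W s} = ⊤ := by
  refine span_eq_top_of_constants p (fun u hu v hv => ?_)
    (fun s hs => Submodule.subset_span (powChar hs)) fun f hf E => ?_
  · induction hu using Submodule.span_induction with
    | zero => simp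
    | add a b _ _ iha ihb => rw [add_lie]; exact add_mem iha ihb
    | smul g a ha iha =>
      rw [Derivation.smul_lie_eq]
      exact sub_mem (Submodule.smul_mem _ _ iha) (Submodule.smul_mem _ _ ha)
    | mem s hs =>
      induction hv using Submodule.span_induction with
      | zero => simp
      | add a b _ _ iha ihb => rw [lie_add]; exact add_mem iha ihb
      | smul g a ha iha =>
        rw [Derivation.lie_smul_eq]
        exact add_mem (Submodule.smul_mem _ _ iha) (Submodule.smul_mem _ _ ha)
      | mem t ht => exact Submodule.subset_span (of_mem (lie_mem hW hs ht))
  · have h := hconst f fun w hw => hf w (of_mem hw)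
    rw [← E.liftKaehlerDifferential_comp_D, h, map_zero]

end IsIteratedPowChar

theorem exists_form_of_functional [FiniteDimensional K (Derivation k K K)]
    (φ : Module.Dual K (Derivation k K K)) :
    ∃ ω : Ω[K⁄k], ∀ v : Derivation k K K, v.liftKaehlerDifferential ω = φ v := by
  let e : Module.Dual K Ω[K⁄k] ≃ₗ[K] Derivation k K K :=
    KaehlerDifferential.linearMapEquivDerivation k K
  have : Module.Finite K (Module.Dual K Ω[K⁄k]) := Module.Finite.equiv e.symm
  have : Module.Finite K Ω[K⁄k] := (Module.finite_dual_iff K).1 this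
  refine ⟨(Module.evalEquiv K Ω[K⁄k]).symm (φ ∘ₗ e.toLinearMap), fun v => ?_⟩
  rw [Module.apply_evalEquiv_symm_apply]
  exact congrArg φ (e.apply_symm_apply v)

theorem isClosedRationalOneForm_of_span_eq_top {ω : Ω[K⁄k]} {G : Set (Derivation k K K)}
    (hG : Submodule.span K G = ⊤)
    (hω : ∀ u ∈ G, ∀ v ∈ G, u (v.liftKaehlerDifferential ω) - v (u.liftKaehlerDifferential ω) =
      (⁅u, v⁆ : Derivation k K K).liftKaehlerDifferential ω) :
    IsClosedRationalOneForm k K ω := by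
  let e : Derivation k K K ≃ₗ[K] Module.Dual K Ω[K⁄k] :=
    (KaehlerDifferential.linearMapEquivDerivation k K).symm
  have hadd : ∀ u v : Derivation k K K, (u + v).liftKaehlerDifferential ω =
      u.liftKaehlerDifferential ω + v.liftKaehlerDifferential ω := fun u v =>
    congrArg (fun l : Module.Dual K Ω[K⁄k] => l ω) (map_add e u v)
  have hsmul : ∀ (g : K) (v : Derivation k K K), (g • v).liftKaehlerDifferential ω =
      g * v.liftKaehlerDifferential ω := fun g v =>
    congrArg (fun l : Module.Dual K Ω[K⁄k] => l ω) (map_smul e g v)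
  have hzero : (0 : Derivation k K K).liftKaehlerDifferential ω = 0 := by
    simpa using hsmul 0 0
  have hsub : ∀ u v : Derivation k K K, (u - v).liftKaehlerDifferential ω =
      u.liftKaehlerDifferential ω - v.liftKaehlerDifferential ω := fun u v =>
    congrArg (fun l : Module.Dual K Ω[K⁄k] => l ω) (map_sub e u v)
  intro u v
  have hu : u ∈ Submodule.span K G := hG ▸ Submodule.mem_top
  have hv : v ∈ Submodule.span K G := hG ▸ Submodule.mem_top
  induction hu using Submodule.span_induction with
  | zero => simp [hzero]
  | add a b _ _ iha ihb =>
    rw [add_lie, hadd, hadd, ← iha, ← ihb, map_add, Derivation.add_apply]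
    ring
  | smul g a _ iha =>
    rw [Derivation.smul_lie_eq, hsub, hsmul, hsmul, hsmul, ← iha, Derivation.leibniz]
    simp
    ring
  | mem s hs =>
    induction hv using Submodule.span_induction with
    | zero => simp [hzero]
    | add a b _ _ iha ihb =>
      rw [lie_add, hadd, hadd, ← iha, ← ihb, map_add, Derivation.add_apply]
      ring
    | smul g a _ iha =>
      rw [Derivation.lie_smul_eq, hadd, hsmul, hsmul, hsmul, ← iha, Derivation.leibniz]
      simp
      ring
    | mem t ht => exact hω s hs t ht

/-- The closed rational `1`-forms vanishing on a `p`-dense foliation cut it out. -/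
theorem exists_closed_form_ne_zero (p : ℕ) [Fact p.Prime] [CharP k p]
    [FiniteDimensional K (Derivation k K K)] {W : Submodule K (Derivation k K K)}
    (hW : ∀ u ∈ W, ∀ v ∈ W, ⁅u, v⁆ ∈ W)
    (hconst : ∀ f : K, (∀ w ∈ W, w f = 0) → KaehlerDifferential.D k K f = 0)
    {u : Derivation k K K} (hu : u ∉ W) :
    ∃ ω : Ω[K⁄k], IsClosedRationalOneForm k K ω ∧
      (∀ w ∈ W, w.liftKaehlerDifferential ω = 0) ∧ u.liftKaehlerDifferential ω ≠ 0 := by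
  have htop := IsIteratedPowChar.span_eq_top (p := p) hW hconst
  have hspan : ⊤ ≤ Submodule.span K (W.mkQ '' {s | IsIteratedPowChar p W s}) := by
    rw [← Submodule.map_span, htop, Submodule.map_top, Submodule.range_mkQ]
  classical
  let b := Module.Basis.ofSpan hspan
  obtain ⟨i, hi⟩ : ∃ i, b.repr (W.mkQ u) i ≠ 0 := by
    by_contra! h
    refine hu ((Submodule.Quotient.mk_eq_zero W).1 (b.repr.injective ?_))
    rw [map_zero]
    exact Finsupp.ext h
  obtain ⟨ω, hω⟩ := exists_form_of_functional (k := k) (K := K) (b.coord i ∘ₗ W.mkQ)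
  have hωW : ∀ w ∈ W, w.liftKaehlerDifferential ω = 0 := fun w hw => by
    rw [hω, LinearMap.comp_apply, Submodule.mkQ_apply, (Submodule.Quotient.mk_eq_zero W).2 hw,
      map_zero]
  let G : Set (Derivation k K K) :=
    {s | IsIteratedPowChar p W s ∧ (s ∈ W ∨ W.mkQ s ∈ Set.range b)}
  have hWG : W ≤ Submodule.span K G := fun w hw =>
    Submodule.subset_span ⟨.of_mem hw, .inl hw⟩
  have hG : Submodule.span K G = ⊤ := by
    have h : Submodule.map W.mkQ (Submodule.span K G) = ⊤ := by
      rw [eq_top_iff, ← b.span_eq, Submodule.map_span, Submodule.span_le]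
      rintro _ ⟨j, rfl⟩
      obtain ⟨s, hs, hsj⟩ := Module.Basis.ofSpan_subset hspan ⟨j, rfl⟩
      exact Submodule.subset_span ⟨s, ⟨hs, .inr ⟨j, hsj.symm⟩⟩, hsj⟩
    rw [Submodule.map_mkQ_eq_top, sup_eq_right.2 hWG] at h
    exact h
  have hval : ∀ s ∈ G, ∀ v : Derivation k K K, v (s.liftKaehlerDifferential ω) = 0 := by
    rintro s ⟨-, hs | ⟨j, hj⟩⟩ v
    · rw [hωW s hs, map_zero]
    · rw [hω, LinearMap.comp_apply, ← hj, Module.Basis.coord_apply, Module.Basis.repr_self,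
        Finsupp.single_apply]
      split_ifs <;> simp
  refine ⟨ω, isClosedRationalOneForm_of_span_eq_top hG fun s hs t ht => ?_, hωW, ?_⟩
  · rw [hval s hs, hval t ht, hωW _ (hs.1.lie_mem hW ht.1), sub_zero]
  · rw [hω]
    exact hi

theorem mem_tangentEnd_iff {W : Submodule K (Derivation k K K)} {v : Derivation k K K} :
    (v.toLinearMap : Module.End k K) ∈ tangentEnd k K W ↔ v ∈ W := by
  refine ⟨fun h => ?_, fun h => Submodule.subset_span ⟨v, h, rfl⟩⟩
  have key : ∀ φ ∈ tangentEnd k K W, ∃ D ∈ W, Derivation.toLinearMap D = φ := by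
    intro φ hφ
    induction hφ using Submodule.span_induction with
    | mem φ hφ => exact hφ
    | zero => exact ⟨0, W.zero_mem, rfl⟩
    | add φ ψ _ _ hφ hψ =>
      obtain ⟨D, hD, rfl⟩ := hφ
      obtain ⟨E, hE, rfl⟩ := hψ
      exact ⟨D + E, W.add_mem hD hE, rfl⟩
    | smul g φ _ hφ =>
      obtain ⟨D, hD, rfl⟩ := hφ
      exact ⟨g • D, W.smul_mem g hD, rfl⟩
  obtain ⟨D, hD, h⟩ := key _ h
  rwa [← Derivation.toLinearMap_injective h]

end Operators

theorem kernel_of_pCurvature_eq_saturation_of_intersection_with_cartier_transform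
    (p : ℕ) [Fact p.Prime]
    (k : Type) [Field k] [IsAlgClosed k] [CharP k p]
    -- `K` is the function field of the smooth algebraic variety `X` over `k`:
    (K : Type) [Field K] [Algebra k K]
    (hfg : ∃ s : Finset K, IntermediateField.adjoin k (s : Set K) = ⊤)
    (hfd : FiniteDimensional K (Derivation k K K))
    -- the foliation `F`, given by `W = T_F`:
    (W : Submodule K (Derivation k K K))
    (hinv : ∀ u ∈ W, ∀ v ∈ W, ⁅u, v⁆ ∈ W)
    -- `F` is `p`-dense:
    (hpdense : ∀ f : K, (∀ D ∈ W, D f = 0) → KaehlerDifferential.D k K f = 0) :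
    -- conclusion: the kernel of the `p`-curvature of `F` coincides with the
    -- saturation of `T_F ∩ T_{C(F)}` in `T_X` (equality of rational sections):
    ∀ v : Derivation k K K,
      (v ∈ W ∧ (Derivation.toLinearMap v : Module.End k K) ^ p ∈ tangentEnd k K W)
        ↔ (v ∈ W ∧ InCartierTransform p k K W v) := by
  intro v
  refine and_congr_right fun hv => ⟨fun h ω _ hωW vp hvp => ?_, fun h => ?_⟩
  · rw [← hvp, mem_tangentEnd_iff] at h
    rw [hωW vp h, hωW v hv, map_zero, sub_zero]
  · rw [← Derivation.toLinearMap_powChar, mem_tangentEnd_iff]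
    by_contra hvp
    obtain ⟨ω, hω, hωW, hne⟩ := exists_closed_form_ne_zero p hinv hpdense hvp
    refine hne ?_
    have h' := h ω hω hωW (v.powChar p) (v.toLinearMap_powChar p)
    rwa [hωW v hv, map_zero, sub_zero] at h'
end
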